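/- Suppose the Hermitian form ⟨·,·⟩ is orthomodular and E contains an infinite orthogonal sequence e₁, e₂, … of nonzero vectors (⟨eᵢ, eⱼ⟩ = 0 for i ≠ j) such that ⟨eᵢ, eᵢ⟩ = ⟨eⱼ, eⱼ⟩ for all i, j. Then K, with its involution, is isomorphic as a ring with involution to ℝ with the identity involution, ℂ with complex conjugation, or ℍ with quaternionic conjugation; that is, there exists a ring isomorphism φ from K onto ℝ, ℂ, or ℍ satisfying φ(ρ*) = φ(ρ)* for all ρ ∈ K. -/

import Mathlib

/-- A (nondegenerate) Hermitian space: a division ring `K` with an involution,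
a left `K`-vector space `E`, and a Hermitian form on `E`. -/
structure HermitianSpace (K E : Type*) [DivisionRing K] [AddCommGroup E] [Module K E] where
  star : K → K
  star_add : ∀ a b : K, star (a + b) = star a + star b
  star_mul : ∀ a b : K, star (a * b) = star b * star a
  star_star : ∀ a : K, star (star a) = a
  form : E → E → K
  form_add_left : ∀ x y z : E, form (x + y) z = form x z + form y z
  form_add_right : ∀ x y z : E, form x (y + z) = form x y + form x z
  form_smul_left : ∀ (ρ : K) (x y : E), form (ρ • x) y = ρ * form x y
  form_smul_right : ∀ (ρ : K) (x y : E), form x (ρ • y) = form x y * star ρ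
  nondeg : ∀ a : E, (∀ x : E, form a x = 0) → a = 0
  hermitian : ∀ x y : E, star (form x y) = form y x

namespace HermitianSpace

variable {K E : Type*} [DivisionRing K] [AddCommGroup E] [Module K E]

/-- The orthogonal companion `M^⊥` of a subspace `M`. -/
def perp (h : HermitianSpace K E) (M : Submodule K E) : Submodule K E where
  carrier := {x : E | ∀ m ∈ M, h.form x m = 0}
  add_mem' := fun {a b} ha hb => by
    intro m hm
    rw [h.form_add_left, ha m hm, hb m hm, add_zero]
  zero_mem' := by
    intro m hm
    have h0 : h.form ((0 : K) • (0 : E)) m = 0 * h.form 0 m := h.form_smul_left 0 0 m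
    simpa using h0
  smul_mem' := fun c a ha => by
    intro m hm
    rw [h.form_smul_left, ha m hm, mul_zero]

/-- The form is orthomodular when `M + M^⊥ = E` for every closed subspace `M`. -/
def Orthomodular (h : HermitianSpace K E) : Prop :=
  ∀ M : Submodule K E, h.perp (h.perp M) = M → M ⊔ h.perp M = ⊤

/-- The form is anisotropic when `⟨x, x⟩ ≠ 0` for every nonzero `x`. -/
def Anisotropic (h : HermitianSpace K E) : Prop :=
  ∀ x : E, x ≠ 0 → h.form x x ≠ 0

end HermitianSpace

namespace HermitianSpace

variable {K E : Type*} [DivisionRing K] [AddCommGroup E] [Module K E]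

/-- The involution of a Hermitian space, as a star ring structure on its division ring. -/
abbrev starRing (h : HermitianSpace K E) : StarRing K where
  star := h.star
  star_involutive := h.star_star
  star_mul := h.star_mul
  star_add := h.star_add

theorem star_zero (h : HermitianSpace K E) : h.star 0 = 0 :=
  letI := h.starRing
  _root_.star_zero K

theorem star_one (h : HermitianSpace K E) : h.star 1 = 1 :=
  letI := h.starRing
  _root_.star_one K

theorem star_neg (h : HermitianSpace K E) (a : K) : h.star (-a) = -h.star a :=
  letI := h.starRing
  _root_.star_neg a

theorem star_sub (h : HermitianSpace K E) (a b : K) : h.star (a - b) = h.star a - h.star b :=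
  letI := h.starRing
  _root_.star_sub a b

theorem star_inv (h : HermitianSpace K E) (a : K) : h.star a⁻¹ = (h.star a)⁻¹ :=
  letI := h.starRing
  star_inv₀ a

theorem star_ratCast (h : HermitianSpace K E) (q : ℚ) : h.star (q : K) = q :=
  letI := h.starRing
  _root_.star_ratCast q

theorem form_zero_left (h : HermitianSpace K E) (x : E) : h.form 0 x = 0 := by
  simpa using h.form_smul_left 0 0 x

theorem form_zero_right (h : HermitianSpace K E) (x : E) : h.form x 0 = 0 := by
  simpa [h.star_zero] using h.form_smul_right 0 x 0

theorem form_neg_left (h : HermitianSpace K E) (x y : E) : h.form (-x) y = -h.form x y := by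
  simpa using h.form_smul_left (-1) x y

theorem form_neg_right (h : HermitianSpace K E) (x y : E) : h.form x (-y) = -h.form x y := by
  simpa [h.star_neg, h.star_one] using h.form_smul_right (-1) x y

theorem form_sub_left (h : HermitianSpace K E) (x y z : E) :
    h.form (x - y) z = h.form x z - h.form y z := by
  rw [sub_eq_add_neg, h.form_add_left, h.form_neg_left, sub_eq_add_neg]

theorem form_sub_right (h : HermitianSpace K E) (x y z : E) :
    h.form x (y - z) = h.form x y - h.form x z := by
  rw [sub_eq_add_neg, h.form_add_right, h.form_neg_right, sub_eq_add_neg]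

theorem form_eq_zero_comm (h : HermitianSpace K E) {x y : E} :
    h.form x y = 0 ↔ h.form y x = 0 := by
  rw [← h.hermitian x y]
  exact ⟨fun hx => by rw [hx, h.star_zero],
    fun hx => by rw [← h.star_star (h.form x y), hx, h.star_zero]⟩

/-- The closed subspace generated by a set. -/
def cl (h : HermitianSpace K E) (X : Set E) : Submodule K E :=
  h.perp (h.perp (Submodule.span K X))

theorem mem_perp_span (h : HermitianSpace K E) {X : Set E} {y : E} :
    y ∈ h.perp (Submodule.span K X) ↔ ∀ f ∈ X, h.form y f = 0 := by
  refine ⟨fun hy f hf => hy f (Submodule.subset_span hf), fun hy m hm => ?_⟩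
  induction hm using Submodule.span_induction with
  | mem x hx => exact hy x hx
  | zero => exact h.form_zero_right y
  | add a b _ _ ha hb => rw [h.form_add_right, ha, hb, add_zero]
  | smul c a _ ha => rw [h.form_smul_right, ha, zero_mul]

theorem mem_cl (h : HermitianSpace K E) {X : Set E} {p : E} :
    p ∈ h.cl X ↔ ∀ y, (∀ f ∈ X, h.form y f = 0) → h.form p y = 0 :=
  ⟨fun hp y hy => hp y (h.mem_perp_span.2 hy), fun hp y hy => hp y (h.mem_perp_span.1 hy)⟩

theorem subset_cl (h : HermitianSpace K E) (X : Set E) : X ⊆ h.cl X := fun _ hx =>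
  h.mem_cl.2 fun _ hy => h.form_eq_zero_comm.1 (hy _ hx)

theorem cl_le (h : HermitianSpace K E) {X Y : Set E} (hXY : X ⊆ h.cl Y) : h.cl X ≤ h.cl Y :=
  fun _ hp => h.mem_cl.2 fun y hy => h.mem_cl.1 hp y fun _ hf =>
    h.form_eq_zero_comm.1 (h.mem_cl.1 (hXY hf) y hy)

theorem form_eq_zero_of_mem_cl (h : HermitianSpace K E) {X Y : Set E}
    (hXY : ∀ x ∈ X, ∀ y ∈ Y, h.form x y = 0) {p q : E} (hp : p ∈ h.cl X) (hq : q ∈ h.cl Y) :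
    h.form p q = 0 :=
  h.mem_cl.1 hp q fun x hx => h.mem_cl.1 hq x fun y hy => hXY x hx y hy

theorem perp_perp_perp (h : HermitianSpace K E) (M : Submodule K E) :
    h.perp (h.perp (h.perp M)) = h.perp M :=
  le_antisymm (fun _ hx m hm => hx m fun _ hy => h.form_eq_zero_comm.1 (hy m hm))
    fun _ hx _ hy => h.form_eq_zero_comm.1 (hy _ hx)

theorem Orthomodular.exists_proj {h : HermitianSpace K E} (hom : h.Orthomodular) (X : Set E)
    (x : E) : ∃ p ∈ h.cl X, ∀ f ∈ X, h.form (x - p) f = 0 := by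
  have hx : x ∈ h.cl X ⊔ h.perp (h.cl X) := by
    rw [hom (h.cl X) (h.perp_perp_perp _)]
    trivial
  obtain ⟨p, hp, q, hq, rfl⟩ := Submodule.mem_sup.1 hx
  refine ⟨p, hp, fun f hf => ?_⟩
  rw [add_sub_cancel_left]
  exact hq f (h.subset_cl X hf)

theorem Orthomodular.eq_zero {h : HermitianSpace K E} (hom : h.Orthomodular) {x : E}
    (hx : h.form x x = 0) : x = 0 := by
  refine h.nondeg x fun z => ?_
  obtain ⟨p, hp, hzp⟩ := hom.exists_proj {x} z
  have h1 := h.mem_cl.1 hp x (by simpa using hx)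
  have h2 := hzp x rfl
  rw [h.form_sub_left, h1, sub_zero] at h2
  exact h.form_eq_zero_comm.1 h2

theorem Orthomodular.eq_of_mem_cl {h : HermitianSpace K E} (hom : h.Orthomodular) {X : Set E}
    {x y : E} (hx : x ∈ h.cl X) (hy : y ∈ h.cl X) (hxy : ∀ f ∈ X, h.form x f = h.form y f) :
    x = y := by
  refine sub_eq_zero.1 (hom.eq_zero (h.mem_cl.1 (sub_mem hx hy) _ fun f hf => ?_))
  rw [h.form_sub_left, hxy f hf, sub_self]

/-- A family of mutually orthogonal vectors of norm one. -/
structure IsOrthonormal (h : HermitianSpace K E) {ι : Type*} (e : ι → E) : Prop where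
  self : ∀ i, h.form (e i) (e i) = 1
  ortho : ∀ i j, i ≠ j → h.form (e i) (e j) = 0

theorem IsOrthonormal.comp {h : HermitianSpace K E} {ι κ : Type*} {e : ι → E}
    (he : h.IsOrthonormal e) {f : κ → ι} (hf : Function.Injective f) :
    h.IsOrthonormal (e ∘ f) :=
  ⟨fun _ => he.self _, fun _ _ hij => he.ortho _ _ fun H => hij (hf H)⟩

theorem IsOrthonormal.charZero {h : HermitianSpace K E} (hom : h.Orthomodular) {e : ℕ → E}
    (he : h.IsOrthonormal e) : CharZero K := by
  refine charZero_of_inj_zero fun n hn => ?_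
  have key : ∀ n : ℕ, h.form (∑ i ∈ Finset.range n, e i) (∑ i ∈ Finset.range n, e i) = n ∧
      ∀ m ≥ n, h.form (∑ i ∈ Finset.range n, e i) (e m) = 0 := by
    intro n
    induction n with
    | zero => simp [h.form_zero_left]
    | succ n ih =>
      have h1 := ih.2 n le_rfl
      refine ⟨?_, fun m hm => ?_⟩
      · rw [Finset.sum_range_succ, h.form_add_left, h.form_add_right, h.form_add_right, ih.1,
          h1, h.form_eq_zero_comm.1 h1, he.self]
        simp
      · rw [Finset.sum_range_succ, h.form_add_left, ih.2 m (by omega), he.ortho n m (by omega),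
          add_zero]
  cases n with
  | zero => rfl
  | succ n =>
    have h0 := hom.eq_zero ((key (n + 1)).1.trans hn)
    have h1 := (key n).2 n le_rfl
    rw [Finset.sum_range_succ] at h0
    rw [eq_neg_of_add_eq_zero_left h0, h.form_neg_left, he.self] at h1
    simp at h1

/-- The reflection exchanging two orthonormal families carries vectors of the closed span of one
family to vectors of the closed span of the other. -/
theorem Orthomodular.exists_copy {h : HermitianSpace K E} (hom : h.Orthomodular) [CharZero K]
    {ι : Type*} {u v : ι → E} (hu : h.IsOrthonormal u) (hv : h.IsOrthonormal v)
    (huv : ∀ i j, h.form (u i) (v j) = 0) {x : E} (hx : x ∈ h.cl (Set.range u)) :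
    ∃ x' ∈ h.cl (Set.range v), h.form x' x' = h.form x x ∧
      ∀ i, h.form x' (v i) = h.form x (u i) := by
  classical
  have hvu : ∀ i j, h.form (v i) (u j) = 0 := fun i j => h.form_eq_zero_comm.1 (huv j i)
  set X : Set E := Set.range fun i => u i + v i with hX
  have hself : ∀ i j, h.form (u i - v i) (u j + v j) = 0 := by
    intro i j
    rw [h.form_sub_left, h.form_add_right, h.form_add_right, huv, hvu]
    by_cases hij : i = j
    · subst hij
      simp [hu.self, hv.self]
    · simp [hu.ortho i j hij, hv.ortho i j hij]
  have hcl : ∀ p ∈ h.cl X, ∀ i, h.form p (u i) = h.form p (v i) := by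
    intro p hp i
    rw [← sub_eq_zero, ← h.form_sub_right]
    refine h.mem_cl.1 hp _ ?_
    rintro _ ⟨j, rfl⟩
    exact hself i j
  have hproj : ∀ y p, p ∈ h.cl X → (∀ f ∈ X, h.form (y - p) f = 0) → ∀ i,
      2 * h.form p (u i) = h.form y (u i) + h.form y (v i) := by
    intro y p hp hyp i
    have h1 := hyp _ ⟨i, rfl⟩
    rw [h.form_sub_left, h.form_add_right, h.form_add_right, ← hcl p hp i, sub_eq_zero] at h1
    rw [h1, two_mul]
  have hxv : ∀ i, h.form x (v i) = 0 := by
    intro i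
    refine h.mem_cl.1 hx _ ?_
    rintro _ ⟨j, rfl⟩
    exact hvu i j
  obtain ⟨p, hp, hxp⟩ := hom.exists_proj X x
  have h2 : ∀ y z : E, h.form ((2 : K) • y) z = 2 * h.form y z := fun y z =>
    h.form_smul_left 2 y z
  have h2' : ∀ y z : E, h.form y ((2 : K) • z) = 2 * h.form y z := by
    intro y z
    rw [two_smul, h.form_add_right, two_mul]
  have hpx : h.form p (x - p) = 0 := h.mem_cl.1 hp _ hxp
  have hxp' : h.form (x - p) p = 0 := h.form_eq_zero_comm.1 hpx
  rw [h.form_sub_right, sub_eq_zero] at hpx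
  rw [h.form_sub_left, sub_eq_zero] at hxp'
  refine ⟨(2 : K) • p - x, h.mem_cl.2 fun y hy => ?_, ?_, fun i => ?_⟩
  · obtain ⟨q, hq, hyq⟩ := hom.exists_proj X y
    have e1 : h.form p (y - q) = 0 := h.mem_cl.1 hp _ hyq
    have e2 : h.form q (x - p) = 0 := h.mem_cl.1 hq _ hxp
    have e2 := h.form_eq_zero_comm.1 e2
    rw [h.form_sub_right, sub_eq_zero] at e1
    rw [h.form_sub_left, sub_eq_zero] at e2
    have e3 : h.form x ((2 : K) • q - y) = 0 := by
      refine h.mem_cl.1 hx _ ?_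
      rintro _ ⟨i, rfl⟩
      rw [h.form_sub_left, h2, hproj y q hq hyq, hy _ ⟨i, rfl⟩, add_zero, sub_self]
    rw [h.form_sub_left, h2, e1, ← e2]
    rwa [h.form_sub_right, h2'] at e3
  · simp only [h.form_sub_left, h.form_sub_right, h2, h2', hpx, hxp']
    noncomm_ring
  · rw [h.form_sub_left, h2, ← hcl p hp, hproj x p hp hxp, hxv]
    simp

theorem star_natCast (h : HermitianSpace K E) (n : ℕ) : h.star (n : K) = n :=
  letI := h.starRing
  _root_.star_natCast n

theorem Orthomodular.exists_restrict {h : HermitianSpace K E} (hom : h.Orthomodular) (X : Set E)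
    (x : E) : ∃ p ∈ h.cl X, ∀ f ∈ X, h.form p f = h.form x f := by
  obtain ⟨p, hp, hxp⟩ := hom.exists_proj X x
  refine ⟨p, hp, fun f hf => ?_⟩
  have := hxp f hf
  rw [h.form_sub_left, sub_eq_zero] at this
  exact this.symm

theorem Orthomodular.form_self_of_shift {h : HermitianSpace K E} (hom : h.Orthomodular)
    [CharZero K] {u v : ℕ → E} (hu : h.IsOrthonormal u) (hv : h.IsOrthonormal v)
    (huv : ∀ i j, h.form (u i) (v j) = 0) {y : E} (hy : y ∈ h.cl (Set.range u)) {l : K}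
    (hyl : ∀ n, h.form y (u (n + 1)) = l * h.form y (u n)) :
    h.form y y = l * h.form y y * h.star l + h.form y (u 0) * h.star (h.form y (u 0)) := by
  have hus := hu.comp (Nat.succ_injective)
  obtain ⟨z, hz, hzy⟩ := hom.exists_restrict (Set.range (u ∘ Nat.succ)) y
  obtain ⟨y', hy', hyy', hyc⟩ := hom.exists_copy hu hv huv hy
  obtain ⟨z', hz', hzz', hzc⟩ := hom.exists_copy hus hv (fun i j => huv _ _) hz
  have hzl : z' = l • y' := by
    refine hom.eq_of_mem_cl hz' (Submodule.smul_mem _ _ hy') ?_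
    rintro _ ⟨n, rfl⟩
    rw [hzc, h.form_smul_left, hyc, hzy _ ⟨n, rfl⟩]
    exact hyl n
  have hz0 : h.form z (u 0) = 0 := by
    refine h.mem_cl.1 hz _ ?_
    rintro _ ⟨n, rfl⟩
    exact hu.ortho _ _ (by simp)
  have hyz : y = z + h.form y (u 0) • u 0 := by
    refine hom.eq_of_mem_cl hy (add_mem (h.cl_le ?_ hz)
      (Submodule.smul_mem _ _ (h.subset_cl _ ⟨0, rfl⟩))) ?_
    · rintro _ ⟨n, rfl⟩
      exact h.subset_cl _ ⟨_, rfl⟩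
    · rintro _ ⟨n, rfl⟩
      rw [h.form_add_left, h.form_smul_left]
      cases n with
      | zero => rw [hz0, hu.self, zero_add, mul_one]
      | succ n => rw [hu.ortho 0 (n + 1) (by simp), mul_zero, add_zero]; exact (hzy _ ⟨n, rfl⟩).symm
  have h1 : h.form z z = l * h.form y y * h.star l := by
    rw [← hzz', hzl, h.form_smul_left, h.form_smul_right, hyy', mul_assoc]
  conv_lhs => rw [hyz]
  simp only [h.form_add_left, h.form_add_right, h.form_smul_left, h.form_smul_right, hz0,
    h.form_eq_zero_comm.1 hz0, hu.self, h1]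
  simp

theorem Orthomodular.exists_geometric_aux {h : HermitianSpace K E} (hom : h.Orthomodular)
    [CharZero K] {e : ℕ → E} (he : h.IsOrthonormal e) :
    ∃ (a : ℕ → ℕ) (z : E), Function.Injective a ∧ z ∈ h.cl (Set.range (e ∘ a)) ∧
      ∀ k, h.form z (e (a k)) = (((1 / 2 ^ (k + 2) : ℚ)) : K) := by
  classical
  set S : ℕ → E := fun n => ∑ i ∈ Finset.range n, e i with hS
  have hS1 : ∀ n, S (n + 1) = S n + e n := fun n => Finset.sum_range_succ _ _
  have heS : ∀ n m, h.form (e m) (S n) = if m < n then 1 else 0 := by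
    intro n m
    induction n with
    | zero => simp [hS, h.form_zero_right]
    | succ n ih =>
      rw [hS1, h.form_add_right, ih]
      rcases lt_trichotomy m n with hmn | rfl | hmn
      · rw [he.ortho m n hmn.ne, if_pos hmn, if_pos (by omega), add_zero]
      · simp [he.self]
      · rw [he.ortho m n hmn.ne', if_neg (by omega), if_neg (by omega), add_zero]
  have hSS : ∀ n m, m ≤ n → h.form (S m) (S n) = m := by
    intro n m
    induction m with
    | zero => simp [hS, h.form_zero_left]
    | succ m ih =>
      intro hmn
      rw [hS1, h.form_add_left, ih (by omega), heS, if_pos (by omega)]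
      simp
  have hSe : ∀ m n, m ≤ n → h.form (S m) (e n) = 0 := by
    intro m n hmn
    rw [h.form_eq_zero_comm, heS, if_neg (by omega)]
  set g : ℕ → E := fun n => S n - (n : K) • e n with hg
  have hgg : ∀ m n, m < n → h.form (g m) (g n) = 0 := by
    intro m n hmn
    simp only [hg, h.form_sub_left, h.form_sub_right, h.form_smul_left, h.form_smul_right,
      hSS n m hmn.le, heS, if_pos hmn, hSe m n hmn.le, he.ortho m n hmn.ne]
    simp
  have hgg' : ∀ m n, m ≠ n → h.form (g m) (g n) = 0 := fun m n hmn =>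
    (lt_or_gt_of_ne hmn).elim (hgg m n) fun h' => h.form_eq_zero_comm.1 (hgg n m h')
  obtain ⟨b, hb, hbe⟩ := hom.exists_restrict {x | ∃ n, Even n ∧ x = g n} (e 0)
  have hbdiff : ∀ n, Odd n → h.form b (e n - e (n + 1)) = ((1 / (n + 1) : ℚ) : K) := by
    intro n hn
    have h1 : h.form b (g n) = 0 := by
      refine h.mem_cl.1 hb _ ?_
      rintro _ ⟨m, hm, rfl⟩
      refine hgg' _ _ fun H => ?_
      subst H
      exact (Nat.not_odd_iff_even.2 hm) hn
    have h2 : h.form b (g (n + 1)) = 1 := by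
      rw [hbe _ ⟨n + 1, hn.add_one, rfl⟩]
      simp only [hg, h.form_sub_right, heS, h.form_smul_right, he.ortho 0 (n + 1) (by simp)]
      simp
    have h3 : g (n + 1) - g n = ((n + 1 : ℕ) : K) • (e n - e (n + 1)) := by
      simp only [hg, hS1]
      push_cast
      simp only [smul_sub, add_smul, one_smul]
      abel
    have h4 : h.form b (g (n + 1) - g n) = 1 := by rw [h.form_sub_right, h1, h2, sub_zero]
    rw [h3, h.form_smul_right, h.star_natCast] at h4
    push_cast at h4 ⊢
    rw [one_div]
    exact eq_inv_of_mul_eq_one_left h4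
  have hodd : ∀ k, Odd (2 ^ (k + 1) - 1) := fun k =>
    Nat.Even.sub_odd Nat.one_le_two_pow (Nat.even_pow.2 ⟨even_two, by simp⟩) odd_one
  set a : ℕ → ℕ := fun k => 2 ^ (k + 1) - 1 with ha
  have hainj : Function.Injective a := by
    intro j k hjk
    have h1 : 1 ≤ 2 ^ (j + 1) := Nat.one_le_two_pow
    have h2 : 1 ≤ 2 ^ (k + 1) := Nat.one_le_two_pow
    have h3 : 2 ^ (j + 1) = 2 ^ (k + 1) := by
      simp only [ha] at hjk
      omega
    simpa using Nat.pow_right_injective le_rfl h3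
  obtain ⟨y, hy, hyb⟩ := hom.exists_restrict
    (Set.range fun k => e (a k) - e (a k + 1)) b
  obtain ⟨z, hz, hzy⟩ := hom.exists_restrict (Set.range (e ∘ a)) y
  refine ⟨a, z, hainj, hz, fun k => ?_⟩
  have h1 : h.form y (e (a k) + e (a k + 1)) = 0 := by
    refine h.mem_cl.1 hy _ ?_
    rintro _ ⟨j, rfl⟩
    have hne : ∀ i j, a i ≠ a j + 1 := by
      intro i j H
      have h5 := hodd i
      have h6 := hodd j
      simp only [ha] at H
      rw [H] at h5
      exact (Nat.not_odd_iff_even.2 h6.add_one) h5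
    rw [h.form_add_left, h.form_sub_right, h.form_sub_right, he.ortho _ _ (hne k j),
      he.ortho _ _ (hne j k).symm]
    by_cases hjk : k = j
    · subst hjk
      simp [he.self]
    · rw [he.ortho _ _ (hainj.ne hjk), he.ortho (a k + 1) (a j + 1) (by simpa using hainj.ne hjk)]
      simp
  have h2 : h.form y (e (a k) - e (a k + 1)) = ((1 / 2 ^ (k + 1) : ℚ) : K) := by
    rw [hyb _ ⟨k, rfl⟩, hbdiff _ (hodd k)]
    have h5 : a k + 1 = 2 ^ (k + 1) := Nat.sub_add_cancel Nat.one_le_two_pow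
    have h6 : ((a k : ℕ) : ℚ) + 1 = 2 ^ (k + 1) := by exact_mod_cast h5
    rw [h6]
  have h3 : h.form z (e (a k)) = h.form y (e (a k)) := hzy _ ⟨k, rfl⟩
  rw [h3]
  rw [h.form_add_right] at h1
  rw [h.form_sub_right] at h2
  have h4 : 2 * h.form y (e (a k)) = ((1 / 2 ^ (k + 1) : ℚ) : K) := by
    rw [← h2, two_mul]
    nth_rewrite 2 [eq_neg_of_add_eq_zero_left h1]
    rw [sub_eq_add_neg]
  refine mul_left_cancel₀ (two_ne_zero (α := K)) (h4.trans ?_)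
  rw [show (2 : K) = ((2 : ℚ) : K) by norm_num, ← Rat.cast_mul]
  congr 1
  field_simp
  ring

/-- The closed span of a row of a doubly indexed family. -/
def row (h : HermitianSpace K E) (e : ℕ × ℕ → E) (i : ℕ) : Submodule K E :=
  h.cl (Set.range fun j => e (i, j))

/-- The closed span of all rows but the first of a doubly indexed family. -/
def rowsSucc (h : HermitianSpace K E) (e : ℕ × ℕ → E) : Submodule K E :=
  h.cl (Set.range fun p : ℕ × ℕ => e (p.1 + 1, p.2))

/-- The values of the quadratic form on the first row of a doubly indexed family. -/
def cone (h : HermitianSpace K E) (e : ℕ × ℕ → E) : Set K :=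
  {s | ∃ x ∈ h.row e 0, h.form x x = s}

theorem row_le_rowsSucc (h : HermitianSpace K E) (e : ℕ × ℕ → E) (i : ℕ) :
    h.row e (i + 1) ≤ h.rowsSucc e := by
  refine h.cl_le ?_
  rintro _ ⟨j, rfl⟩
  exact h.subset_cl _ ⟨(i, j), rfl⟩

theorem mem_row (h : HermitianSpace K E) (e : ℕ × ℕ → E) (i j : ℕ) : e (i, j) ∈ h.row e i :=
  h.subset_cl _ ⟨j, rfl⟩

section grid

variable {h : HermitianSpace K E} {e : ℕ × ℕ → E}

theorem IsOrthonormal.row (he : h.IsOrthonormal e) (i : ℕ) :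
    h.IsOrthonormal fun j => e (i, j) :=
  he.comp (f := fun j => (i, j)) fun _ _ hjk => (Prod.mk.inj hjk).2

theorem IsOrthonormal.form_row (he : h.IsOrthonormal e) {i j : ℕ} (hij : i ≠ j) {x y : E}
    (hx : x ∈ h.row e i) (hy : y ∈ h.row e j) : h.form x y = 0 := by
  refine h.form_eq_zero_of_mem_cl ?_ hx hy
  rintro _ ⟨a, rfl⟩ _ ⟨b, rfl⟩
  exact he.ortho _ _ fun H => hij (Prod.mk.inj H).1

theorem IsOrthonormal.one_mem_cone (he : h.IsOrthonormal e) : (1 : K) ∈ h.cone e :=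
  ⟨_, h.mem_row e 0 0, he.self _⟩

theorem star_of_mem_cone {s : K} (hs : s ∈ h.cone e) : h.star s = s := by
  obtain ⟨x, -, rfl⟩ := hs
  exact h.hermitian x x

theorem conj_mem_cone {s : K} (hs : s ∈ h.cone e) (k : K) : k * s * h.star k ∈ h.cone e := by
  obtain ⟨x, hx, rfl⟩ := hs
  exact ⟨k • x, Submodule.smul_mem _ _ hx, by rw [h.form_smul_left, h.form_smul_right, mul_assoc]⟩

variable [CharZero K]

theorem IsOrthonormal.form_self_mem_cone (he : h.IsOrthonormal e) (hom : h.Orthomodular) {x : E}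
    (hx : x ∈ h.rowsSucc e) : h.form x x ∈ h.cone e := by
  have hu : h.IsOrthonormal fun p : ℕ × ℕ => e (p.1 + 1, p.2) :=
    he.comp (f := fun p : ℕ × ℕ => (p.1 + 1, p.2)) fun p q hpq => by
      simpa [Prod.ext_iff] using hpq
  have hv : h.IsOrthonormal fun p : ℕ × ℕ => e (0, Nat.pair p.1 p.2) :=
    he.comp (f := fun p : ℕ × ℕ => (0, Nat.pair p.1 p.2)) fun p q hpq => by
      simpa [Prod.ext_iff] using hpq
  obtain ⟨x', hx', hxx, -⟩ := hom.exists_copy hu hv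
    (fun p q => he.ortho _ _ fun H => by simp at H) hx
  refine ⟨x', h.cl_le ?_ hx', hxx⟩
  rintro _ ⟨p, rfl⟩
  exact h.mem_row e 0 _

theorem IsOrthonormal.exists_of_mem_cone (he : h.IsOrthonormal e) (hom : h.Orthomodular) {s : K}
    (hs : s ∈ h.cone e) (i : ℕ) : ∃ x ∈ h.row e (i + 1), h.form x x = s := by
  obtain ⟨x, hx, rfl⟩ := hs
  obtain ⟨x', hx', hxx, -⟩ := hom.exists_copy (he.row 0) (he.row (i + 1))
    (fun p q => he.ortho _ _ fun H => by simp at H) hx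
  exact ⟨x', hx', hxx⟩

theorem IsOrthonormal.exists_geometric (he : h.IsOrthonormal e) (hom : h.Orthomodular) :
    ∃ x ∈ h.row e 1, (∀ n, h.form x (e (1, n)) = ((1 / 2 ^ n : ℚ) : K)) ∧
      h.form x x = ((4 / 3 : ℚ) : K) := by
  obtain ⟨a, z, ha, hz, hza⟩ := hom.exists_geometric_aux (he.row 0)
  obtain ⟨y, hy, -, hyc⟩ := hom.exists_copy ((he.row 0).comp ha) (he.row 1)
    (fun p q => he.ortho _ _ fun H => by simp at H) hz
  have hx : ∀ n, h.form ((4 : K) • y) (e (1, n)) = ((1 / 2 ^ n : ℚ) : K) := by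
    intro n
    have h1 := (hyc n).trans (hza n)
    rw [h.form_smul_left, h1, show (4 : K) = ((4 : ℚ) : K) by norm_num, ← Rat.cast_mul]
    congr 1
    field_simp
    ring
  have hmem : (4 : K) • y ∈ h.row e 1 := Submodule.smul_mem _ _ hy
  refine ⟨_, hmem, hx, ?_⟩
  have h2 := hom.form_self_of_shift (he.row 1) (he.row 0)
    (fun p q => he.ortho _ _ fun H => by simp at H) hmem (l := ((1 / 2 : ℚ) : K)) (by
      intro n
      rw [hx, hx, ← Rat.cast_mul]
      congr 1
      field_simp
      ring)
  rw [hx, h.star_ratCast, h.star_ratCast] at h2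
  set t := h.form ((4 : K) • y) ((4 : K) • y)
  rw [mul_assoc, ← (Rat.cast_commute (1 / 2 : ℚ) t).eq, ← mul_assoc] at h2
  push_cast at h2 ⊢
  have h3 : (3 / 4 : K) * t = 1 := by
    have : (3 / 4 : K) * t = t - 1 / 2 * (1 / 2) * t := by
      rw [← one_sub_mul]
      norm_num
    rw [this]
    nth_rewrite 1 [h2]
    norm_num
  calc t = 4 / 3 * (3 / 4 * t) := by rw [← mul_assoc]; norm_num
    _ = 4 / 3 := by rw [h3, mul_one]

theorem IsOrthonormal.eq_zero_of_const (he : h.IsOrthonormal e) (hom : h.Orthomodular) {p : E}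
    {c : K} (hp : ∀ n, h.form p (e (1, n)) = c) : c = 0 := by
  obtain ⟨y, hy, hyp⟩ := hom.exists_restrict (Set.range fun j => e (1, j)) p
  have hyc : ∀ n, h.form y (e (1, n)) = c := fun n => (hyp _ ⟨n, rfl⟩).trans (hp n)
  have h2 := hom.form_self_of_shift (he.row 1) (he.row 0)
    (fun p q => he.ortho _ _ fun H => by simp at H) hy (l := 1) (by
      intro n
      rw [hyc, hyc, one_mul])
  rw [hyc, h.star_one, one_mul, mul_one, left_eq_add] at h2
  rcases mul_eq_zero.1 h2 with h3 | h3
  · exact h3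
  · rw [← h.star_star c, h3, h.star_zero]

theorem IsOrthonormal.add_mem_cone (he : h.IsOrthonormal e) (hom : h.Orthomodular) {s t : K}
    (hs : s ∈ h.cone e) (ht : t ∈ h.cone e) : s + t ∈ h.cone e := by
  obtain ⟨x, hx, rfl⟩ := he.exists_of_mem_cone hom hs 0
  obtain ⟨y, hy, rfl⟩ := he.exists_of_mem_cone hom ht 1
  have hxy := he.form_row (by simp) hx hy
  have := he.form_self_mem_cone hom
    (add_mem (h.row_le_rowsSucc e _ hx) (h.row_le_rowsSucc e _ hy))
  simpa [h.form_add_left, h.form_add_right, hxy, h.form_eq_zero_comm.1 hxy] using this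

theorem IsOrthonormal.eq_zero_of_neg_mem_cone (he : h.IsOrthonormal e) (hom : h.Orthomodular)
    {s : K} (hs : s ∈ h.cone e) (hs' : -s ∈ h.cone e) : s = 0 := by
  obtain ⟨x, hx, rfl⟩ := he.exists_of_mem_cone hom hs 0
  obtain ⟨y, hy, hyx⟩ := he.exists_of_mem_cone hom hs' 1
  have hxy := he.form_row (by simp) hx hy
  have h1 : x + y = 0 := hom.eq_zero <| by
    simp [h.form_add_left, h.form_add_right, hxy, h.form_eq_zero_comm.1 hxy, hyx]
  rw [eq_neg_of_add_eq_zero_right h1, h.form_neg_right, neg_eq_zero] at hxy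
  exact hxy

theorem IsOrthonormal.eq_zero_of_infinitesimal (he : h.IsOrthonormal e) (hom : h.Orthomodular)
    {t : K} (ht : ∀ n : ℕ, ((1 / 2 ^ n : ℚ) : K) - t * h.star t ∈ h.cone e) : t = 0 := by
  choose g hg hgt using fun n => he.exists_of_mem_cone hom (ht n) (n + 1)
  obtain ⟨x, hx, hxe, -⟩ := he.exists_geometric hom
  set f : ℕ → E := fun n => t • e (1, n) + g n with hf
  have heg : ∀ m n, h.form (e (1, m)) (g n) = 0 := fun m n =>
    he.form_row (by simp) (h.mem_row e 1 m) (hg n)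
  have hgg : ∀ m n, m ≠ n → h.form (g m) (g n) = 0 := fun m n hmn =>
    he.form_row (by simpa using hmn) (hg m) (hg n)
  have hee : ∀ m n, m ≠ n → h.form (e (1, m)) (e (1, n)) = 0 := fun m n hmn =>
    (he.row 1).ortho m n hmn
  have hff : ∀ m n, m ≠ n → h.form (f m) (f n) = 0 := by
    intro m n hmn
    simp [hf, h.form_add_left, h.form_add_right, h.form_smul_left, h.form_smul_right, heg,
      h.form_eq_zero_comm.1 (heg _ _), hgg m n hmn, hee m n hmn]
  have hfs : ∀ n, h.form (f n) (f n) = ((1 / 2 ^ n : ℚ) : K) := by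
    intro n
    simp only [hf, h.form_add_left, h.form_add_right, h.form_smul_left, h.form_smul_right, heg,
      h.form_eq_zero_comm.1 (heg _ _), hgt, he.self]
    simp
  have hef : ∀ m n, m ≠ n → h.form (e (1, m)) (f n) = 0 := by
    intro m n hmn
    simp [hf, h.form_add_right, h.form_smul_right, heg, hee m n hmn]
  have hefs : ∀ n, h.form (e (1, n)) (f n) = h.star t := by
    intro n
    simp [hf, h.form_add_right, h.form_smul_right, heg, he.self]
  have hxf : ∀ n, h.form x (f n) = ((1 / 2 ^ n : ℚ) : K) * h.star t := by
    intro n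
    have : h.form x (g n) = 0 := he.form_row (by simp) hx (hg n)
    rw [h.form_add_right, h.form_smul_right, hxe, this, add_zero]
  obtain ⟨p, hp, hpx⟩ := hom.exists_restrict (Set.range f) x
  have hpe : ∀ n, h.form p (e (1, n)) = h.star t * t := by
    intro n
    have h1 : h.form p (e (1, n) - (h.star t * ((2 ^ n : ℚ) : K)) • f n) = 0 := by
      refine h.mem_cl.1 hp _ ?_
      rintro _ ⟨m, rfl⟩
      rw [h.form_sub_left, h.form_smul_left]
      by_cases hnm : n = m
      · subst hnm
        rw [hefs, hfs, mul_assoc, ← Rat.cast_mul]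
        simp
      · rw [hef n m hnm, hff n m hnm, mul_zero, sub_zero]
    rw [h.form_sub_right, h.form_smul_right, hpx _ ⟨n, rfl⟩, hxf, sub_eq_zero] at h1
    rw [h1, h.star_mul, h.star_star, h.star_ratCast, ← mul_assoc,
      (Rat.cast_commute (1 / 2 ^ n : ℚ) (h.star t)).eq, mul_assoc (h.star t), ← Rat.cast_mul]
    simp
  rcases mul_eq_zero.1 (he.eq_zero_of_const hom hpe) with h3 | h3
  · rw [← h.star_star t, h3, h.star_zero]
  · exact h3

theorem IsOrthonormal.exists_series (he : h.IsOrthonormal e) (hom : h.Orthomodular) {s : ℕ → K}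
    (hs : ∀ n, s n ∈ h.cone e) (hs' : ∀ n, 1 - s n ∈ h.cone e) :
    ∃ t ∈ h.cone e, ∀ N : ℕ,
      t - ∑ n ∈ Finset.range N, ((1 / 4 ^ n : ℚ) : K) * s n ∈ h.cone e ∧
      ((4 / 3 / 4 ^ N : ℚ) : K) -
        (t - ∑ n ∈ Finset.range N, ((1 / 4 ^ n : ℚ) : K) * s n) ∈ h.cone e := by
  have hst : ∀ n, h.star (s n) = s n := fun n => star_of_mem_cone (hs n)
  have hmem : ∀ n, s n - s n * s n ∈ h.cone e := by
    intro n
    have h1 := he.add_mem_cone hom (conj_mem_cone (hs' n) (s n)) (conj_mem_cone (hs n) (1 - s n))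
    rw [h.star_sub, h.star_one, hst] at h1
    convert h1 using 1
    noncomm_ring
  choose g hg hgs using fun n => he.exists_of_mem_cone hom (hmem n) (n + 1)
  obtain ⟨x, hx, hxe, hxx⟩ := he.exists_geometric hom
  set f : ℕ → E := fun n => s n • e (1, n) + g n with hf
  have heg : ∀ m n, h.form (e (1, m)) (g n) = 0 := fun m n =>
    he.form_row (by simp) (h.mem_row e 1 m) (hg n)
  have hgg : ∀ m n, m ≠ n → h.form (g m) (g n) = 0 := fun m n hmn =>
    he.form_row (by simpa using hmn) (hg m) (hg n)
  have hee : ∀ m n, m ≠ n → h.form (e (1, m)) (e (1, n)) = 0 := fun m n hmn =>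
    (he.row 1).ortho m n hmn
  have hff : ∀ m n, m ≠ n → h.form (f m) (f n) = 0 := by
    intro m n hmn
    simp [hf, h.form_add_left, h.form_add_right, h.form_smul_left, h.form_smul_right, heg,
      h.form_eq_zero_comm.1 (heg _ _), hgg m n hmn, hee m n hmn]
  have hfs : ∀ n, h.form (f n) (f n) = s n := by
    intro n
    simp only [hf, h.form_add_left, h.form_add_right, h.form_smul_left, h.form_smul_right, heg,
      h.form_eq_zero_comm.1 (heg _ _), hgs, he.self, hst]
    simp
  have hef : ∀ m n, m ≠ n → h.form (e (1, m)) (f n) = 0 := by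
    intro m n hmn
    simp [hf, h.form_add_right, h.form_smul_right, heg, hee m n hmn]
  have hefs : ∀ n, h.form (e (1, n)) (f n) = s n := by
    intro n
    simp [hf, h.form_add_right, h.form_smul_right, heg, he.self, hst]
  have hxg : ∀ y ∈ h.row e 1, ∀ n, h.form y (f n) = h.form y (e (1, n)) * s n := by
    intro y hy n
    have : h.form y (g n) = 0 := he.form_row (by simp) hy (hg n)
    rw [h.form_add_right, h.form_smul_right, hst, this, add_zero]
  obtain ⟨p, hp, hpx⟩ := hom.exists_restrict (Set.range f) x
  have hle : h.cl (Set.range f) ≤ h.rowsSucc e := by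
    refine h.cl_le ?_
    rintro _ ⟨n, rfl⟩
    exact add_mem (Submodule.smul_mem _ _ (h.row_le_rowsSucc e 0 (h.mem_row e 1 n)))
      (h.row_le_rowsSucc e _ (hg n))
  have key : ∀ N : ℕ, ∃ y q, y ∈ h.row e 1 ∧ q ∈ h.cl (Set.range f) ∧
      (∀ n, h.form q (f n) = h.form y (f n)) ∧
      (∀ n ≥ N, h.form y (e (1, n)) = ((1 / 2 ^ n : ℚ) : K)) ∧
      h.form y y = ((4 / 3 / 4 ^ N : ℚ) : K) ∧
      h.form q q = h.form p p - ∑ n ∈ Finset.range N, ((1 / 4 ^ n : ℚ) : K) * s n := by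
    intro N
    induction N with
    | zero => exact ⟨x, p, hx, hp, fun n => hpx _ ⟨n, rfl⟩, fun n _ => hxe n, by simpa using hxx,
        by simp⟩
    | succ N ih =>
      obtain ⟨y, q, hy, hq, hqy, hye, hyy, hqq⟩ := ih
      set w : K := ((1 / 2 ^ N : ℚ) : K) with hw
      have hws : h.star w = w := h.star_ratCast _
      have hwc : ∀ k, w * k = k * w := fun k => (Rat.cast_commute _ k).eq
      have hww : w * w = ((1 / 4 ^ N : ℚ) : K) := by
        rw [hw, ← Rat.cast_mul]
        congr 1
        rw [show (4 : ℚ) = 2 * 2 by norm_num, mul_pow]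
        field_simp
      have hyw : h.form y (e (1, N)) = w := hye N le_rfl
      have hyw' : h.form (e (1, N)) y = w := by rw [← h.hermitian, hyw, hws]
      have hqw : h.form q (f N) = w * s N := by rw [hqy, hxg y hy, hyw]
      have hqw' : h.form (f N) q = s N * w := by rw [← h.hermitian, hqw, h.star_mul, hws, hst]
      refine ⟨y - w • e (1, N), q - w • f N,
        sub_mem hy (Submodule.smul_mem _ _ (h.mem_row e 1 N)),
        sub_mem hq (Submodule.smul_mem _ _ (h.subset_cl _ ⟨N, rfl⟩)), fun n => ?_,
        fun n hn => ?_, ?_, ?_⟩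
      · rw [h.form_sub_left, h.form_sub_left, hqy, h.form_smul_left, h.form_smul_left]
        by_cases hn : N = n
        · subst hn
          rw [hfs, hefs]
        · rw [hff N n hn, hef N n hn]
      · rw [h.form_sub_left, h.form_smul_left, hye n (by omega), hee N n (by omega), mul_zero,
          sub_zero]
      · simp only [h.form_sub_left, h.form_sub_right, h.form_smul_left, h.form_smul_right, hyw,
          hyw', hws, he.self, hyy, one_mul, sub_self, sub_zero, hww]
        rw [← Rat.cast_sub]
        congr 1
        field_simp
        ring
      · simp only [h.form_sub_left, h.form_sub_right, h.form_smul_left, h.form_smul_right, hqw,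
          hqw', hws, hfs, hqq, Finset.sum_range_succ, ← hww]
        simp only [mul_assoc, hwc (s N)]
        rw [show s N * (w * w) = w * (s N * w) from
          (mul_assoc _ _ _).symm.trans (hwc (s N * w)).symm]
        abel
  refine ⟨h.form p p, he.form_self_mem_cone hom (hle hp), fun N => ?_⟩
  obtain ⟨y, q, hy, hq, hqy, -, hyy, hqq⟩ := key N
  rw [← hqq, ← hyy]
  refine ⟨he.form_self_mem_cone hom (hle hq), ?_⟩
  have h1 : h.form q (y - q) = 0 := by
    refine h.mem_cl.1 hq _ ?_
    rintro _ ⟨n, rfl⟩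
    rw [h.form_sub_left, hqy, sub_self]
  have h2 : h.form y y - h.form q q = h.form (y - q) (y - q) := by
    have h3 := h.form_eq_zero_comm.1 h1
    rw [h.form_sub_right, sub_eq_zero] at h1
    rw [h.form_sub_left, sub_eq_zero] at h3
    rw [h.form_sub_left, h.form_sub_right, h.form_sub_right, h1, h3]
    abel
  rw [h2]
  exact he.form_self_mem_cone hom (sub_mem (h.row_le_rowsSucc e 0 hy) (hle hq))

end grid

end HermitianSpace

theorem IsSumSq.inv {F : Type*} [Field F] {x : F} (hx : IsSumSq x) : IsSumSq x⁻¹ := by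
  by_cases h : x = 0
  · simp [h]
  · have h1 := hx.mul (IsSumSq.mul_self x⁻¹)
    rwa [← mul_assoc, mul_inv_cancel₀ h, one_mul] at h1

/-- Newton's iteration for the square root of `a`, started at `1`. -/
def newtonSqrt {F : Type*} [Field F] (a : F) : ℕ → F
  | 0 => 1
  | n + 1 => (newtonSqrt a n + a / newtonSqrt a n) / 2

section newton

variable {F : Type*} [Field F] [CharZero F] {a : F}

theorem newtonSqrt_pos (hF : ∀ x : F, IsSumSq x → IsSumSq (-x) → x = 0) (ha : IsSumSq a) (n : ℕ) :
    IsSumSq (newtonSqrt a n) ∧ newtonSqrt a n ≠ 0 := by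
  have h2 : IsSumSq (2 : F)⁻¹ := IsSumSq.inv (by simpa using IsSumSq.natCast (R := F) 2)
  induction n with
  | zero => exact ⟨by simp [newtonSqrt], one_ne_zero⟩
  | succ n ih =>
    have h1 : IsSumSq (a / newtonSqrt a n) := by
      rw [div_eq_mul_inv]
      exact ha.mul ih.1.inv
    refine ⟨?_, fun h0 => ih.2 (hF _ ih.1 ?_)⟩
    · rw [newtonSqrt, div_eq_mul_inv]
      exact (ih.1.add h1).mul h2
    · rw [newtonSqrt, div_eq_zero_iff] at h0
      simp only [OfNat.ofNat_ne_zero, or_false] at h0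
      rwa [neg_eq_of_add_eq_zero_right h0]

theorem newtonSqrt_sub (hF : ∀ x : F, IsSumSq x → IsSumSq (-x) → x = 0) (ha : IsSumSq a)
    (ha' : IsSumSq (1 - a)) (n : ℕ) :
    IsSumSq (newtonSqrt a n - a / newtonSqrt a n) ∧
    IsSumSq (2 / 2 ^ n - (newtonSqrt a n - a / newtonSqrt a n)) ∧
    IsSumSq (1 - newtonSqrt a n) ∧
    IsSumSq (a / newtonSqrt a (n + 1) - a / newtonSqrt a n) := by
  have h2 : IsSumSq (2 : F)⁻¹ := IsSumSq.inv (by simpa using IsSumSq.natCast (R := F) 2)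
  have hm : ∀ n, IsSumSq (newtonSqrt a n - a / newtonSqrt a n) →
      IsSumSq (a / newtonSqrt a (n + 1) - a / newtonSqrt a n) := by
    intro n h
    have e1 : a / newtonSqrt a (n + 1) - a / newtonSqrt a n =
        (newtonSqrt a n - a / newtonSqrt a n) * 2⁻¹ *
          (a * (newtonSqrt a n)⁻¹ * (newtonSqrt a (n + 1))⁻¹) := by
      have k1 := (newtonSqrt_pos hF ha n).2
      have k2 := (newtonSqrt_pos hF ha (n + 1)).2
      have k3 : newtonSqrt a (n + 1) = (newtonSqrt a n + a / newtonSqrt a n) / 2 := rfl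
      field_simp at k3 ⊢
      linear_combination (-a) * k3
    rw [e1]
    exact (h.mul h2).mul
      ((ha.mul (newtonSqrt_pos hF ha n).1.inv).mul (newtonSqrt_pos hF ha (n + 1)).1.inv)
  have key : IsSumSq (newtonSqrt a n - a / newtonSqrt a n) ∧
      IsSumSq (2 / 2 ^ n - (newtonSqrt a n - a / newtonSqrt a n)) ∧
      IsSumSq (1 - newtonSqrt a n) := by
    induction n with
    | zero =>
      simp only [newtonSqrt, div_one, pow_zero, sub_self]
      refine ⟨ha', ?_, IsSumSq.zero⟩
      refine Eq.mp (congrArg IsSumSq ?_) (IsSumSq.one.add ha)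
      ring
    | succ n ih =>
      obtain ⟨i1, i2, i3⟩ := ih
      have k1 := (newtonSqrt_pos hF ha n).2
      have k2 := (newtonSqrt_pos hF ha (n + 1))
      have k3 : newtonSqrt a (n + 1) = (newtonSqrt a n + a / newtonSqrt a n) / 2 := rfl
      refine ⟨?_, ?_, ?_⟩
      · have e1 : newtonSqrt a (n + 1) - a / newtonSqrt a (n + 1) =
            (newtonSqrt a n - a / newtonSqrt a n) * 2⁻¹ *
              ((newtonSqrt a n - a / newtonSqrt a n) * 2⁻¹) * (newtonSqrt a (n + 1))⁻¹ := by
          have k2 := k2.2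
          have e2 : newtonSqrt a (n + 1) * newtonSqrt a (n + 1) - a =
            (newtonSqrt a n - a / newtonSqrt a n) * 2⁻¹ *
              ((newtonSqrt a n - a / newtonSqrt a n) * 2⁻¹) := by
            rw [k3]
            field_simp
            ring
          rw [← e2]
          field_simp
        rw [e1]
        exact (IsSumSq.mul_self _).mul k2.1.inv
      · refine Eq.mp (congrArg IsSumSq ?_) ((i2.mul h2).add (hm n i1))
        rw [pow_succ]
        have e3 : newtonSqrt a (n + 1) * 2 = newtonSqrt a n + a / newtonSqrt a n := by
          rw [k3]
          field_simp
        linear_combination (1/2) * e3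
      · refine Eq.mp (congrArg IsSumSq ?_) (i3.add (i1.mul h2))
        rw [k3]
        ring
  exact ⟨key.1, key.2.1, key.2.2, hm n key.1⟩

/-- A form of the convergence of Newton's iteration that refers only to sums of squares. -/
theorem exists_series_sqrt (hF : ∀ x : F, IsSumSq x → IsSumSq (-x) → x = 0) (ha : IsSumSq a)
    (ha' : IsSumSq (1 - a)) : ∃ s L : ℕ → F, (∀ n, IsSumSq (s n)) ∧ (∀ n, IsSumSq (1 - s n)) ∧
      (∀ n, L n = a + 2 * ∑ i ∈ Finset.range n, ((1 / 4 ^ i : ℚ) : F) * s i) ∧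
      (∀ n, IsSumSq (L n)) ∧ (∀ n, IsSumSq (1 - L n)) ∧ (∀ n, IsSumSq (a - L n * L n)) ∧
      ∀ n, IsSumSq (((2 / 4 ^ n : ℚ) : F) - (a - L n * L n)) := by
  have h2' : IsSumSq (2 : F) := by simpa using IsSumSq.natCast (R := F) 2
  have h2 : IsSumSq (2 : F)⁻¹ := IsSumSq.inv h2'
  have h4' : ∀ n : ℕ, IsSumSq ((4 : F) ^ n) := fun n => by
    simpa using IsSumSq.natCast (R := F) (4 ^ n)
  have hl : ∀ n, IsSumSq (a / newtonSqrt a n) := fun n => by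
    rw [div_eq_mul_inv]
    exact ha.mul (newtonSqrt_pos hF ha n).1.inv
  have hll : ∀ n, IsSumSq (a / newtonSqrt a (n + 1) - a / newtonSqrt a n) := fun n =>
    (newtonSqrt_sub hF ha ha' n).2.2.2
  have hm : ∀ n, IsSumSq (a / newtonSqrt a (n + 2) - a / newtonSqrt a n) := by
    intro n
    refine Eq.mp (congrArg IsSumSq ?_) ((hll n).add (hll (n + 1)))
    ring
  have hm' : ∀ n, IsSumSq (2 / 2 ^ n - (a / newtonSqrt a (n + 2) - a / newtonSqrt a n)) := by
    intro n
    obtain ⟨-, i2, i3, -⟩ := newtonSqrt_sub hF ha ha' n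
    obtain ⟨j1, -, j3, -⟩ := newtonSqrt_sub hF ha ha' (n + 2)
    have i4 : ∀ n, IsSumSq (newtonSqrt a n - newtonSqrt a (n + 1)) := by
      intro n
      have k3 : newtonSqrt a (n + 1) = (newtonSqrt a n + a / newtonSqrt a n) / 2 := rfl
      refine Eq.mp (congrArg IsSumSq ?_) ((newtonSqrt_sub hF ha ha' n).1.mul h2)
      rw [k3]
      ring
    refine Eq.mp (congrArg IsSumSq ?_) ((i2.add j1).add ((i4 n).add (i4 (n + 1))))
    ring
  refine ⟨fun n => 4 ^ n * (a / newtonSqrt a (2 * n + 2) - a / newtonSqrt a (2 * n)) * 2⁻¹,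
    fun n => a / newtonSqrt a (2 * n), fun n => ((h4' n).mul (hm _)).mul h2, fun n => ?_,
    fun n => ?_, fun n => hl _, fun n => ?_, fun n => ?_, fun n => ?_⟩
  · refine Eq.mp (congrArg IsSumSq ?_) (((h4' n).mul (hm' (2 * n))).mul h2)
    rw [pow_mul, show (2 : F) ^ 2 = 4 by norm_num]
    field_simp
  · induction n with
    | zero => simp [newtonSqrt]
    | succ n ih =>
      simp only at ih ⊢
      rw [Finset.sum_range_succ, mul_add (2 : F), ← add_assoc, ← ih, mul_add 2 n 1, mul_one]
      push_cast
      field_simp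
      ring
  · obtain ⟨i1, -, i3, -⟩ := newtonSqrt_sub hF ha ha' (2 * n)
    refine Eq.mp (congrArg IsSumSq ?_) (i1.add i3)
    ring
  · obtain ⟨i1, -, i3, -⟩ := newtonSqrt_sub hF ha ha' (2 * n)
    refine Eq.mp (congrArg IsSumSq ?_) ((hl (2 * n)).mul i1)
    have := (newtonSqrt_pos hF ha (2 * n)).2
    field_simp
  · obtain ⟨i1, i2, i3, -⟩ := newtonSqrt_sub hF ha ha' (2 * n)
    refine Eq.mp (congrArg IsSumSq ?_) (i2.add (i1.mul (i1.add i3)))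
    push_cast
    rw [pow_mul, show (2 : F) ^ 2 = 4 by norm_num]
    have := (newtonSqrt_pos hF ha (2 * n)).2
    field_simp
    ring

end newton

/-- A set of self-adjoint elements of a division ring with involution which behaves like the set of
nonnegative self-adjoint elements: it is stable under addition and congruence, and suitable series
of its elements converge. -/
structure IsSeriesCone {K : Type*} [DivisionRing K] [StarRing K] (P : Set K) : Prop where
  star_eq : ∀ {s : K}, s ∈ P → star s = s
  conj_mem : ∀ {s : K}, s ∈ P → ∀ k : K, k * s * star k ∈ P
  one_mem : (1 : K) ∈ P
  add_mem : ∀ {s t : K}, s ∈ P → t ∈ P → s + t ∈ P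
  eq_zero_of_neg_mem : ∀ {s : K}, s ∈ P → -s ∈ P → s = 0
  eq_zero_of_infinitesimal : ∀ {t : K}, (∀ n : ℕ, ((1 / 2 ^ n : ℚ) : K) - t * star t ∈ P) → t = 0
  exists_series : ∀ {s : ℕ → K}, (∀ n, s n ∈ P) → (∀ n, 1 - s n ∈ P) → ∃ t ∈ P, ∀ N : ℕ,
    t - ∑ n ∈ Finset.range N, ((1 / 4 ^ n : ℚ) : K) * s n ∈ P ∧
    ((4 / 3 / 4 ^ N : ℚ) : K) - (t - ∑ n ∈ Finset.range N, ((1 / 4 ^ n : ℚ) : K) * s n) ∈ P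

namespace IsSeriesCone

variable {K : Type*} [DivisionRing K] [StarRing K] {P : Set K}

theorem zero_mem (hP : IsSeriesCone P) : (0 : K) ∈ P := by
  simpa using hP.conj_mem hP.one_mem 0

theorem mul_star_mem (hP : IsSeriesCone P) (k : K) : k * star k ∈ P := by
  simpa using hP.conj_mem hP.one_mem k

theorem mul_self_mem (hP : IsSeriesCone P) {s : K} (hs : star s = s) : s * s ∈ P := by
  simpa [hs] using hP.mul_star_mem s

theorem nsmul_mem (hP : IsSeriesCone P) {s : K} (hs : s ∈ P) (n : ℕ) : n • s ∈ P := by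
  induction n with
  | zero => simpa using hP.zero_mem
  | succ n ih => rw [succ_nsmul]; exact hP.add_mem ih hs

theorem map_mem_of_isSumSq {F : Type*} [Field F] (hP : IsSeriesCone P) (f : F →+* K)
    (hf : ∀ x, star (f x) = f x) {x : F} (hx : IsSumSq x) : f x ∈ P := by
  induction hx with
  | zero => simpa using hP.zero_mem
  | sq_add a _ ih =>
    rw [map_add, map_mul]
    exact hP.add_mem (hP.mul_self_mem (hf a)) ih

variable [CharZero K]

theorem smul_mem (hP : IsSeriesCone P) {s : K} (hs : s ∈ P) {q : ℚ} (hq : 0 ≤ q) : q • s ∈ P := by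
  have h1 := hP.conj_mem (hP.nsmul_mem hs (q.num.toNat * q.den)) (((1 / q.den : ℚ)) • (1 : K))
  convert h1 using 1
  simp only [star_rat_smul, star_one, smul_mul_assoc, one_mul, mul_smul_comm, mul_one]
  rw [← Nat.cast_smul_eq_nsmul ℚ, smul_smul, smul_smul]
  congr 1
  have h2 : ((q.num.toNat : ℕ) : ℚ) = q.num := by
    exact_mod_cast Int.toNat_of_nonneg (Rat.num_nonneg.2 hq)
  rw [Nat.cast_mul, h2]
  have h3 : (q.den : ℚ) ≠ 0 := by exact_mod_cast q.den_nz
  field_simp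
  exact (Rat.mul_den_eq_num q)

theorem smul_one_mem (hP : IsSeriesCone P) {q : ℚ} (hq : 0 ≤ q) : q • (1 : K) ∈ P :=
  hP.smul_mem hP.one_mem hq

theorem of_smul_mem (hP : IsSeriesCone P) {s : K} {q : ℚ} (hq : 0 < q) (hs : q • s ∈ P) :
    s ∈ P := by
  simpa [smul_smul, hq.ne'] using hP.smul_mem hs (inv_nonneg.2 hq.le)

theorem nonneg_of_smul_one_mem (hP : IsSeriesCone P) {q : ℚ} (hq : q • (1 : K) ∈ P) : 0 ≤ q := by
  by_contra! h
  have h1 := hP.eq_zero_of_neg_mem hq (by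
    rw [← neg_smul]; exact hP.smul_one_mem (by linarith))
  rw [smul_eq_zero] at h1
  simp [h.ne] at h1

/-- The elements `x` for which `q ^ 2 - x * star x` lies in `P`. -/
def ball (P : Set K) (q : ℚ) : Set K :=
  {x | (q * q) • (1 : K) - x * star x ∈ P}

theorem mem_ball {x : K} {q : ℚ} : x ∈ ball P q ↔ (q * q) • (1 : K) - x * star x ∈ P :=
  Iff.rfl

theorem ball_mono (hP : IsSeriesCone P) {x : K} {q r : ℚ} (hx : x ∈ ball P q) (hq : 0 ≤ q)
    (hqr : q ≤ r) : x ∈ ball P r := by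
  have h1 := hP.add_mem hx (hP.smul_one_mem (q := r * r - q * q) (by nlinarith))
  rw [mem_ball]
  convert h1 using 1
  module

theorem neg_mem_ball {x : K} {q : ℚ} (hx : x ∈ ball P q) : -x ∈ ball P q := by
  simpa [mem_ball] using hx

theorem add_mem_ball (hP : IsSeriesCone P) {x y : K} {q r : ℚ} (hq : 0 < q) (hr : 0 < r)
    (hx : x ∈ ball P q) (hy : y ∈ ball P r) : x + y ∈ ball P (q + r) := by
  rw [mem_ball] at *
  have h1 := hP.smul_mem hx (q := 1 + r / q) (by positivity)
  have h2 := hP.smul_mem hy (q := 1 + q / r) (by positivity)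
  have h3 := hP.smul_mem (hP.mul_star_mem ((r / q) • x - y)) (q := q / r) (by positivity)
  convert hP.add_mem (hP.add_mem h1 h2) h3 using 1
  simp only [star_add, star_sub, star_rat_smul, mul_add, add_mul, mul_sub, sub_mul,
    smul_mul_assoc, mul_smul_comm]
  match_scalars <;> field_simp <;> ring

theorem sub_mem_ball (hP : IsSeriesCone P) {x y : K} {q r : ℚ} (hq : 0 < q) (hr : 0 < r)
    (hx : x ∈ ball P q) (hy : y ∈ ball P r) : x - y ∈ ball P (q + r) := by
  rw [sub_eq_add_neg]
  exact hP.add_mem_ball hq hr hx (neg_mem_ball hy)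

theorem mul_mem_ball (hP : IsSeriesCone P) {x y : K} {q r : ℚ}
    (hx : x ∈ ball P q) (hy : y ∈ ball P r) : x * y ∈ ball P (q * r) := by
  rw [mem_ball] at *
  convert hP.add_mem (hP.smul_mem hx (mul_self_nonneg r)) (hP.conj_mem hy x) using 1
  simp only [star_mul, mul_sub, sub_mul, smul_mul_assoc, mul_smul_comm, mul_one, mul_assoc]
  match_scalars <;> ring

theorem mem_ball_of_symm (hP : IsSeriesCone P) {s : K} {q : ℚ} (hq : 0 < q) (hs : star s = s)
    (h1 : q • (1 : K) - s ∈ P) (h2 : q • (1 : K) + s ∈ P) : s ∈ ball P q := by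
  rw [mem_ball, hs]
  refine hP.of_smul_mem (q := 2 * q) (by positivity) ?_
  convert hP.add_mem (hP.conj_mem h2 (q • (1 : K) - s)) (hP.conj_mem h1 (q • (1 : K) + s)) using 1
  simp only [star_add, star_sub, star_rat_smul, star_one, hs, mul_add, add_mul, mul_sub, sub_mul,
    smul_mul_assoc, mul_smul_comm, mul_one, one_mul, mul_assoc]
  match_scalars <;> ring

theorem eq_zero_of_mem_ball (hP : IsSeriesCone P) {x : K} {C : ℚ} (hC : 0 ≤ C)
    (hx : ∀ n : ℕ, x ∈ ball P (C / 4 ^ n)) : x = 0 := by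
  refine hP.eq_zero_of_infinitesimal fun n => ?_
  obtain ⟨N, hN⟩ := exists_pow_lt_of_lt_one (show (0 : ℚ) < 1 / 2 ^ n / (C + 1) by positivity)
    (show (1 / 4 : ℚ) < 1 by norm_num)
  have h1 : C / 4 ^ N ≤ 1 / 2 ^ n := by
    rw [lt_div_iff₀ (by positivity), one_div_pow] at hN
    rw [div_eq_mul_one_div]
    have : (0 : ℚ) < 1 / 4 ^ N := by positivity
    nlinarith
  have h2 := hP.ball_mono (hx N) (by positivity) h1
  have h3 : (1 / 2 ^ n : ℚ) ≤ 1 := by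
    rw [div_le_one (by positivity)]
    exact one_le_pow₀ (by norm_num)
  have h4 : (0 : ℚ) < 1 / 2 ^ n := by positivity
  convert hP.add_mem h2 (hP.smul_one_mem (q := 1 / 2 ^ n - 1 / 2 ^ n * (1 / 2 ^ n))
    (by nlinarith)) using 1
  rw [← Rat.smul_one_eq_cast]
  module

/-- Inside a commutative subfield of self-adjoint elements, `c ^ 2` has a square root in `P`. -/
theorem exists_sqrt {F : Type*} [Field F] [CharZero F] (hP : IsSeriesCone P) (f : F →+* K)
    (hf : ∀ x, star (f x) = f x) {c : F} (hc : IsSumSq (1 - c * c)) :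
    ∃ r ∈ P, Commute r (f c) ∧ r * r = f c * f c := by
  have hQ : ∀ {x : F}, IsSumSq x → f x ∈ P := hP.map_mem_of_isSumSq f hf
  have hF : ∀ x : F, IsSumSq x → IsSumSq (-x) → x = 0 := by
    intro x h1 h2
    have h3 := hP.eq_zero_of_neg_mem (hQ h1) (by rw [← map_neg]; exact hQ h2)
    simpa using h3
  obtain ⟨s, L, hs, hs', hL, hL0, hL1, hLa, hLa'⟩ :=
    exists_series_sqrt hF (IsSumSq.mul_self c) hc
  obtain ⟨t, ht, htN⟩ := hP.exists_series (s := fun n => f (s n)) (fun n => hQ (hs n))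
    (fun n => by rw [← map_one f, ← map_sub]; exact hQ (hs' n))
  have hcast : ∀ q : ℚ, f (q : F) = q • (1 : K) := fun q => by
    rw [map_ratCast, Rat.smul_one_eq_cast]
  set r := f (c * c) + 2 • t with hr
  have hrP : r ∈ P := hP.add_mem (hQ (IsSumSq.mul_self c)) (hP.nsmul_mem ht 2)
  have hrL : ∀ N, r - f (L N) = 2 • (t - ∑ n ∈ Finset.range N, ((1 / 4 ^ n : ℚ) : K) * f (s n)) := by
    intro N
    rw [hL, hr, map_add, map_mul f 2, map_sum]
    simp only [map_mul, map_ratCast, map_ofNat]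
    simp only [two_mul, two_smul]
    abel
  have hd : ∀ N, r - f (L N) ∈ ball P (8 / 3 / 4 ^ N) := by
    intro N
    rw [hrL]
    refine hP.mem_ball_of_symm (by positivity) ?_ ?_ ?_
    · exact hP.star_eq (hP.nsmul_mem (htN N).1 2)
    · refine Eq.mp (congrArg (· ∈ P) ?_) (hP.nsmul_mem (htN N).2 2)
      rw [← Rat.smul_one_eq_cast]
      module
    · exact hP.add_mem (hP.smul_one_mem (by positivity)) (hP.nsmul_mem (htN N).1 2)
  have hLb : ∀ N, f (L N) ∈ ball P 1 := by
    intro N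
    refine hP.mem_ball_of_symm one_pos (hf _) ?_ ?_
    · rw [one_smul, ← map_one f, ← map_sub]
      exact hQ (hL1 N)
    · rw [one_smul]
      exact hP.add_mem hP.one_mem (hQ (hL0 N))
  have hab : ∀ N, f (c * c - L N * L N) ∈ ball P (2 / 4 ^ N) := by
    intro N
    refine hP.mem_ball_of_symm (by positivity) (hf _) ?_ ?_
    · rw [← hcast, ← map_sub]
      exact hQ (hLa' N)
    · exact hP.add_mem (hP.smul_one_mem (by positivity)) (hQ (hLa N))
  have hcb : f c ∈ ball P 1 := by
    rw [mem_ball, hf, mul_one, one_smul, ← map_one f, ← map_mul, ← map_sub]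
    exact hQ hc
  have hfL : ∀ N, f (L N) * f c = f c * f (L N) := fun N => by
    rw [← map_mul, mul_comm, map_mul]
  refine ⟨r, hrP, ?_, ?_⟩
  · rw [commute_iff_eq, ← sub_eq_zero]
    refine hP.eq_zero_of_mem_ball (C := 16 / 3) (by norm_num) fun N => ?_
    have h1 := hP.sub_mem_ball (by positivity) (by positivity) (hP.mul_mem_ball (hd N) hcb)
      (hP.mul_mem_ball hcb (hd N))
    have e1 : (16 / 3 / 4 ^ N : ℚ) = 8 / 3 / 4 ^ N * 1 + 1 * (8 / 3 / 4 ^ N) := by ring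
    rw [e1]
    refine Eq.mp (congrArg (· ∈ ball P _) ?_) h1
    rw [sub_mul, mul_sub, hfL]
    abel
  · rw [← sub_eq_zero]
    refine hP.eq_zero_of_mem_ball (C := 128 / 9 + 2) (by norm_num) fun N => ?_
    have h1 := hP.sub_mem_ball (by positivity) (by positivity)
      (hP.add_mem_ball (by positivity) (by positivity)
        (hP.add_mem_ball (by positivity) (by positivity) (hP.mul_mem_ball (hd N) (hd N))
        (hP.mul_mem_ball (hd N) (hLb N))) (hP.mul_mem_ball (hLb N) (hd N))) (hab N)
    refine hP.ball_mono (Eq.mp (congrArg (· ∈ ball P _) ?_) h1) (by positivity) ?_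
    · rw [map_sub, map_mul, map_mul]
      noncomm_ring
    · have h2 : (1 : ℚ) / 4 ^ N ≤ 1 := by
        rw [div_le_one (by positivity)]
        exact one_le_pow₀ (by norm_num)
      have h3 : (0 : ℚ) < 1 / 4 ^ N := by positivity
      have e : ∀ x : ℚ, x / 4 ^ N = x * (1 / 4 ^ N) := fun x => div_eq_mul_one_div _ _
      rw [e (8 / 3), e 2, e (128 / 9 + 2)]
      nlinarith

/-- The self-adjoint elements of the bicommutant of `s`. -/
def symmBicommutant {K : Type*} [DivisionRing K] [StarRing K] (s : K) : Subfield K where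
  carrier := {x | star x = x ∧ ∀ y, Commute y s → Commute y x}
  mul_mem' := by
    rintro a b ⟨ha, ha'⟩ ⟨hb, hb'⟩
    refine ⟨?_, fun y hy => (ha' y hy).mul_right (hb' y hy)⟩
    rw [star_mul, ha, hb]
    exact ha' b (hb' s (Commute.refl s)).symm
  one_mem' := ⟨star_one K, fun y _ => Commute.one_right y⟩
  add_mem' := by
    rintro a b ⟨ha, ha'⟩ ⟨hb, hb'⟩
    exact ⟨by rw [star_add, ha, hb], fun y hy => (ha' y hy).add_right (hb' y hy)⟩
  zero_mem' := ⟨star_zero K, fun y _ => Commute.zero_right y⟩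
  neg_mem' := by
    rintro a ⟨ha, ha'⟩
    exact ⟨by rw [star_neg, ha], fun y hy => (ha' y hy).neg_right⟩
  inv_mem' := by
    rintro a ⟨ha, ha'⟩
    exact ⟨by rw [star_inv₀, ha], fun y hy => (ha' y hy).inv_right₀⟩

theorem mem_or_neg_mem (hP : IsSeriesCone P) {s : K} (hs : star s = s) : s ∈ P ∨ -s ∈ P := by
  let _ : Field (symmBicommutant s) :=
    { (inferInstance : DivisionRing (symmBicommutant s)) with
      mul_comm := fun a b => Subtype.ext (b.2.2 a (a.2.2 s (Commute.refl s)).symm) }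
  have _ : CharZero (symmBicommutant s) := by
    refine ⟨fun a b hab => ?_⟩
    have := congrArg Subtype.val hab
    simpa using this
  let f : symmBicommutant s →+* K := (symmBicommutant s).subtype
  have hf : ∀ x, star (f x) = f x := fun x => x.2.1
  let x : symmBicommutant s := ⟨s, hs, fun _ h => h⟩
  have hx : f x = s := rfl
  have h1 : 1 + x * x ≠ 0 := by
    intro h
    have h2 := hP.eq_zero_of_neg_mem (hP.map_mem_of_isSumSq f hf (IsSumSq.mul_self x)) (by
      rw [← map_neg, neg_eq_of_add_eq_zero_left h, map_one]
      exact hP.one_mem)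
    rw [map_eq_zero, mul_self_eq_zero] at h2
    simp [h2] at h
  let c := x / (1 + x * x)
  have hc : IsSumSq (1 - c * c) := by
    have h4 := (IsSumSq.one.add (IsSumSq.mul_self x)).add (IsSumSq.mul_self (x * x))
    refine Eq.mp (congrArg IsSumSq ?_) (h4.mul (IsSumSq.mul_self (1 + x * x)⁻¹))
    have h3 : (1 + x * x) * (1 + x * x)⁻¹ = 1 := mul_inv_cancel₀ h1
    have h5 : c = x * (1 + x * x)⁻¹ := div_eq_mul_inv _ _
    rw [h5]
    linear_combination (1 + (1 + x * x) * (1 + x * x)⁻¹) * h3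
  obtain ⟨r, hr, hrc, hrr⟩ := hP.exists_sqrt f hf hc
  have hsc : s = f c + s * f c * s := by
    have h5 : x = c + x * c * x := by
      have h6 : c * (1 + x * x) = x := div_mul_cancel₀ x h1
      linear_combination -h6
    simpa only [map_add, map_mul, hx] using congrArg f h5
  have hmem : ∀ {k : K}, k ∈ P → k + s * k * s ∈ P := fun {k} hk => by
    refine hP.add_mem hk ?_
    simpa [hs] using hP.conj_mem hk s
  have h3 : (r - f c) * (r + f c) = 0 := by
    rw [sub_mul, mul_add, mul_add, hrr, hrc.eq]
    abel
  rcases mul_eq_zero.1 h3 with h4 | h4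
  · left
    rw [sub_eq_zero] at h4
    rw [hsc, ← h4]
    exact hmem hr
  · right
    have h5 : -s = r + s * r * s := by
      rw [eq_neg_of_add_eq_zero_left h4]
      nth_rewrite 1 [hsc]
      noncomm_ring
    rw [h5]
    exact hmem hr

theorem exists_smul_one_sub_mem (hP : IsSeriesCone P) {s : K} (hs : star s = s) :
    ∃ n : ℕ, (n + 1 : ℚ) • (1 : K) - s ∈ P := by
  by_contra! h
  have h1 : ∀ n : ℕ, s - (n + 1 : ℚ) • (1 : K) ∈ P := by
    intro n
    have h2 : star ((n + 1 : ℚ) • (1 : K) - s) = (n + 1 : ℚ) • (1 : K) - s := by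
      rw [star_sub, star_rat_smul, star_one, hs]
    rcases hP.mem_or_neg_mem h2 with h3 | h3
    · exact absurd h3 (h n)
    · rwa [neg_sub] at h3
  have h0 : s ≠ 0 := by
    rintro rfl
    have h2 := h1 0
    simp only [Nat.cast_zero, zero_add, one_smul, zero_sub] at h2
    exact one_ne_zero (hP.eq_zero_of_neg_mem hP.one_mem h2)
  have hi : star s⁻¹ = s⁻¹ := by rw [star_inv₀, hs]
  have hsP : s ∈ P := by
    have := hP.add_mem (h1 0) hP.one_mem
    simpa using this
  have hsi : s⁻¹ ∈ P := by
    have := hP.conj_mem hsP s⁻¹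
    rwa [hi, inv_mul_cancel₀ h0, one_mul] at this
  have h5 : s⁻¹ = 0 := by
    refine hP.eq_zero_of_mem_ball (C := 1) (by norm_num) fun n => ?_
    refine hP.mem_ball_of_symm (by positivity) hi ?_
      (hP.add_mem (hP.smul_one_mem (by positivity)) hsi)
    set m : ℚ := 4 ^ n with hm
    have hmn : ((4 ^ n - 1 : ℕ) : ℚ) + 1 = m := by
      rw [Nat.cast_sub (Nat.one_le_pow _ _ (by norm_num)), hm]
      simp
    have hm0 : 0 < m := by positivity
    have h6 := h1 (4 ^ n - 1)
    rw [hmn] at h6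
    have h7 := hP.smul_mem (hP.add_mem (hP.mul_self_mem (hP.star_eq h6)) (hP.smul_mem h6 hm0.le))
      (q := 1 / m) (by positivity)
    have h8 := hP.conj_mem h7 s⁻¹
    refine Eq.mp (congrArg (· ∈ P) ?_) h8
    have e : (1 / m) • ((s - m • 1) * (s - m • 1) + m • (s - m • 1)) = (1 / m) • (s * s) - s := by
      simp only [mul_sub, sub_mul, smul_mul_assoc, mul_smul_comm, mul_one, one_mul]
      match_scalars <;> field_simp <;> ring
    rw [hi, e]
    simp only [mul_sub, sub_mul, smul_mul_assoc, mul_smul_comm]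
    rw [← mul_assoc, inv_mul_cancel₀ h0, one_mul, mul_inv_cancel₀ h0, one_mul]
  exact h0 (inv_eq_zero.1 h5)

theorem exists_mem_ball (hP : IsSeriesCone P) (k : K) : ∃ n : ℕ, k ∈ ball P (n + 1) := by
  obtain ⟨n, hn⟩ := hP.exists_smul_one_sub_mem (hP.star_eq (hP.mul_star_mem k))
  refine ⟨n, ?_⟩
  have h1 := hP.add_mem hn (hP.smul_one_mem (q := (n + 1) * (n + 1) - (n + 1)) (by
    have : (0 : ℚ) ≤ n := by positivity
    nlinarith))
  refine Eq.mp (congrArg (· ∈ P) ?_) h1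
  module

theorem exists_approx (hP : IsSeriesCone P) {s : K} (hs : star s = s) {ε : ℚ} (hε : 0 < ε) :
    ∃ q : ℚ, s - q • 1 ∈ ball P ε := by
  obtain ⟨n, hn⟩ := hP.exists_smul_one_sub_mem hs
  obtain ⟨m, hm⟩ := hP.exists_smul_one_sub_mem (s := -s) (by rw [star_neg, hs])
  obtain ⟨j, hj, hj'⟩ := Int.exists_greatest_of_bdd (P := fun j : ℤ => s - (j * ε) • 1 ∈ P)
    ⟨⌈(n + 1) / ε⌉, fun j hj => by
      have h1 := hP.add_mem hj hn
      have h2 : (n + 1 - j * ε : ℚ) • (1 : K) ∈ P := by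
        refine Eq.mp (congrArg (· ∈ P) ?_) h1
        module
      have h3 := hP.nonneg_of_smul_one_mem h2
      have h4 : (j : ℚ) ≤ (n + 1) / ε := by
        rw [le_div_iff₀ hε]
        linarith
      exact_mod_cast h4.trans (Int.le_ceil _)⟩
    ⟨⌊-(m + 1) / ε⌋, by
      have h3 : ((⌊-(m + 1) / ε⌋ : ℤ) : ℚ) * ε ≤ -(m + 1) := by
        rw [← le_div_iff₀ hε]
        exact Int.floor_le _
      have h1 := hP.add_mem hm (hP.smul_one_mem (q := -(m + 1) - ⌊-(m + 1) / ε⌋ * ε)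
        (by linarith))
      refine Eq.mp (congrArg (· ∈ P) ?_) h1
      module⟩
  refine ⟨j * ε, hP.mem_ball_of_symm hε (hP.star_eq hj) ?_
    (hP.add_mem (hP.smul_one_mem hε.le) hj)⟩
  have h5 : star (s - ((j + 1 : ℤ) * ε) • (1 : K)) = s - ((j + 1 : ℤ) * ε) • 1 := by
    rw [star_sub, star_rat_smul, star_one, hs]
  rcases hP.mem_or_neg_mem h5 with h6 | h6
  · have := hj' _ h6
    omega
  · refine Eq.mp (congrArg (· ∈ P) ?_) h6
    push_cast
    module

theorem commute_of_symm (hP : IsSeriesCone P) {s : K} (hs : star s = s) (k : K) :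
    Commute s k := by
  obtain ⟨n, hn⟩ := hP.exists_mem_ball k
  rw [commute_iff_eq, ← sub_eq_zero]
  refine hP.eq_zero_of_mem_ball (C := 2 * (n + 1)) (by positivity) fun N => ?_
  obtain ⟨q, hq⟩ := hP.exists_approx hs (ε := 1 / 4 ^ N) (by positivity)
  have h1 := hP.sub_mem_ball (by positivity) (by positivity) (hP.mul_mem_ball hq hn)
    (hP.mul_mem_ball hn hq)
  rw [show (2 * (n + 1) / 4 ^ N : ℚ) = 1 / 4 ^ N * (n + 1) + (n + 1) * (1 / 4 ^ N) by ring]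
  refine Eq.mp (congrArg (· ∈ ball P _) ?_) h1
  simp only [mul_sub, sub_mul, smul_mul_assoc, mul_smul_comm, mul_one, one_mul]
  abel

theorem smul_one_sub_mem_of_mem_ball (hP : IsSeriesCone P) {s : K} (hs : star s = s) {q : ℚ}
    (hq : 0 < q) (h : s ∈ ball P q) : q • (1 : K) - s ∈ P := by
  have h1 : star (q • (1 : K) - s) = q • (1 : K) - s := by
    rw [star_sub, star_rat_smul, star_one, hs]
  rw [mem_ball, hs] at h
  refine hP.of_smul_mem (q := 2 * q) (by positivity) ?_
  refine Eq.mp (congrArg (· ∈ P) ?_) (hP.add_mem h (hP.mul_self_mem h1))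
  simp only [mul_sub, sub_mul, smul_mul_assoc, mul_smul_comm, mul_one, one_mul]
  match_scalars <;> ring

theorem mul_mem (hP : IsSeriesCone P) {a b : K} (ha : a ∈ P) (hb : b ∈ P) : a * b ∈ P := by
  have hs := hP.star_eq ha
  have hab : star (a * b) = a * b := by
    rw [star_mul, hs, hP.star_eq hb, (hP.commute_of_symm hs b).eq]
  rcases hP.mem_or_neg_mem hab with h | h
  · exact h
  · obtain ⟨n, hn⟩ := hP.exists_mem_ball b
    suffices h0 : a * b = 0 by rw [h0]; exact hP.zero_mem
    refine hP.eq_zero_of_mem_ball (C := 2 * (n + 1)) (by positivity) fun N => ?_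
    obtain ⟨q, hq⟩ := hP.exists_approx hs (ε := 1 / 4 ^ N) (by positivity)
    have hε : (0 : ℚ) < 1 / 4 ^ N := by positivity
    rw [show (2 * (n + 1) / 4 ^ N : ℚ) = (1 / 4 ^ N + 1 / 4 ^ N) * (n + 1) by ring]
    set ε : ℚ := 1 / 4 ^ N
    have hsq : star (a - q • (1 : K)) = a - q • (1 : K) := by
      rw [star_sub, star_rat_smul, star_one, hs]
    have h1 : (q + ε) • (1 : K) ∈ P := by
      refine Eq.mp (congrArg (· ∈ P) ?_)
        (hP.add_mem ha (hP.smul_one_sub_mem_of_mem_ball hsq hε hq))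
      module
    have h1 := hP.nonneg_of_smul_one_mem h1
    have h2 : ε • (1 : K) ∈ ball P ε := by
      rw [mem_ball, star_rat_smul, star_one, smul_mul_smul, mul_one, sub_self]
      exact hP.zero_mem
    have h3 := hP.mul_mem_ball (neg_mem_ball (hP.sub_mem_ball hε hε hq h2)) hn
    set d := -(a - q • (1 : K) - ε • (1 : K)) with hd
    have h4 : d * b = (q + ε) • b - a * b := by
      simp only [hd, sub_mul, neg_mul, smul_mul_assoc, one_mul]
      module
    have h5 : star (d * b) = d * b := by
      rw [h4, star_sub, hab, star_rat_smul, hP.star_eq hb]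
    have h6 := hP.smul_one_sub_mem_of_mem_ball h5 (by positivity) h3
    refine hP.mem_ball_of_symm (by positivity) hab ?_ ?_
    · rw [sub_eq_add_neg]
      exact hP.add_mem (hP.smul_one_mem (by positivity)) h
    · refine Eq.mp (congrArg (· ∈ P) ?_) (hP.add_mem h6 (hP.smul_mem hb h1))
      rw [h4]
      abel

/-- The self-adjoint elements, which form a central subfield. -/
def symmSubfield (hP : IsSeriesCone P) : Subfield K where
  carrier := {x | star x = x}
  mul_mem' := by
    intro a b ha hb
    rw [Set.mem_ofPred_eq] at *
    rw [star_mul, ha, hb, (hP.commute_of_symm ha b).eq]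
  one_mem' := star_one K
  add_mem' := by
    intro a b ha hb
    rw [Set.mem_ofPred_eq] at *
    rw [star_add, ha, hb]
  zero_mem' := star_zero K
  neg_mem' := by
    intro a ha
    rw [Set.mem_ofPred_eq] at *
    rw [star_neg, ha]
  inv_mem' := by
    intro a ha
    rw [Set.mem_ofPred_eq] at *
    rw [star_inv₀, ha]

/-- The field structure on the self-adjoint elements. -/
abbrev symmField (hP : IsSeriesCone P) : Field hP.symmSubfield :=
  { (inferInstance : DivisionRing hP.symmSubfield) with
    mul_comm := fun a b => Subtype.ext (hP.commute_of_symm a.2 b) }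

open Classical in
/-- The order on the self-adjoint elements whose nonnegative elements are those of `P`. -/
noncomputable abbrev symmOrder (hP : IsSeriesCone P) : LinearOrder hP.symmSubfield where
  le a b := (b : K) - a ∈ P
  le_refl a := by
    rw [sub_self]
    exact hP.zero_mem
  le_trans a b c hab hbc := by
    refine Eq.mp (congrArg (· ∈ P) ?_) (hP.add_mem hab hbc)
    abel
  le_antisymm a b hab hba := by
    rw [← neg_sub] at hba
    exact Subtype.ext (sub_eq_zero.1 (hP.eq_zero_of_neg_mem hab hba)).symm
  le_total a b := by
    have h : star ((b : K) - a) = b - a := by rw [star_sub, a.2, b.2]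
    rw [← neg_sub (b : K) a]
    exact hP.mem_or_neg_mem h
  toDecidableLE := Classical.decRel _

theorem symm_isStrictOrderedRing (hP : IsSeriesCone P) :
    letI := hP.symmField
    letI := hP.symmOrder
    IsStrictOrderedRing hP.symmSubfield := by
  let _ := hP.symmField
  let _ := hP.symmOrder
  have hle : ∀ a b : hP.symmSubfield, a ≤ b ↔ (b : K) - a ∈ P := fun _ _ => Iff.rfl
  have : IsOrderedAddMonoid hP.symmSubfield :=
    { add_le_add_left := fun a b hab c => by
        rw [hle] at *
        simpa using hab }
  have : ZeroLEOneClass hP.symmSubfield :=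
    ⟨by simpa [hle] using hP.one_mem⟩
  refine IsStrictOrderedRing.of_mul_pos fun a b ha hb => ?_
  refine lt_of_le_of_ne ?_ (mul_ne_zero ha.ne' hb.ne').symm
  have ha := ha.le
  have hb := hb.le
  rw [hle] at *
  simp only [ZeroMemClass.coe_zero, sub_zero] at *
  exact hP.mul_mem ha hb

theorem exists_real_hom (hP : IsSeriesCone P) : ∃ φ : ℝ →+* K,
    (∀ k, star k = k → ∃ r, φ r = k) ∧ (∀ r, star (φ r) = φ r) ∧
    (∀ r k, Commute (φ r) k) ∧ ∀ r, φ r ∈ P → 0 ≤ r := by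
  let _ := hP.symmField
  let _ := hP.symmOrder
  have _ := hP.symm_isStrictOrderedRing
  have hle : ∀ a b : hP.symmSubfield, a ≤ b ↔ (b : K) - a ∈ P := fun _ _ => Iff.rfl
  have hcast : ∀ q : ℚ, ((q : hP.symmSubfield) : K) = q := fun q =>
    map_ratCast hP.symmSubfield.subtype q
  have _ : Archimedean hP.symmSubfield := by
    refine archimedean_iff_nat_le.2 fun x => ?_
    obtain ⟨n, hn⟩ := hP.exists_smul_one_sub_mem x.2
    refine ⟨n + 1, ?_⟩
    rw [hle]
    rw [Rat.smul_one_eq_cast] at hn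
    simpa using hn
  obtain ⟨ψ⟩ := Real.nonemptyOrderRingHom hP.symmSubfield
  have hψ : Function.Surjective ψ := by
    intro r
    set q : ℕ → ℚ := fun n => ⌊r * 4 ^ n⌋ / 4 ^ n with hq
    have hq1 : ∀ n, (q n : ℝ) ≤ r := by
      intro n
      simp only [hq]
      push_cast
      rw [div_le_iff₀ (by positivity)]
      exact Int.floor_le _
    have hq2 : ∀ n, r ≤ q n + 1 / 4 ^ n := by
      intro n
      simp only [hq]
      push_cast
      rw [← add_div, le_div_iff₀ (by positivity)]
      exact (Int.lt_floor_add_one _).le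
    have hq3 : ∀ n, q n ≤ q (n + 1) := by
      intro n
      simp only [hq]
      rw [div_le_div_iff₀ (by positivity) (by positivity), pow_succ, ← mul_assoc, mul_right_comm]
      refine mul_le_mul_of_nonneg_right ?_ (by positivity)
      have : ⌊r * 4 ^ n⌋ * 4 ≤ ⌊r * 4 ^ (n + 1)⌋ := by
        rw [Int.le_floor, pow_succ]
        push_cast
        have := Int.floor_le (r * 4 ^ n)
        linarith
      exact_mod_cast this
    have hq4 : ∀ n, q (n + 1) - q n ≤ 1 / 4 ^ n := by
      intro n
      have h1 := hq1 (n + 1)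
      have h2 := hq2 n
      have h3 : ((q (n + 1) - q n : ℚ) : ℝ) ≤ ((1 / 4 ^ n : ℚ) : ℝ) := by
        push_cast
        linarith
      exact Rat.cast_le.1 h3
    obtain ⟨t, ht, htN⟩ := hP.exists_series (s := fun n => (4 ^ n * (q (n + 1) - q n)) • (1 : K))
      (fun n => hP.smul_one_mem (mul_nonneg (by positivity) (sub_nonneg.2 (hq3 n))))
      (fun n => by
        nth_rewrite 1 [← one_smul ℚ (1 : K)]
        rw [← sub_smul]
        refine hP.smul_one_mem ?_
        have := hq4 n
        rw [le_div_iff₀ (by positivity)] at this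
        linarith)
    have hsum : ∀ N, ∑ n ∈ Finset.range N,
        ((1 / 4 ^ n : ℚ) : K) * (4 ^ n * (q (n + 1) - q n)) • (1 : K) = ((q N - q 0 : ℚ) : K) := by
      intro N
      rw [← Finset.sum_range_sub, Rat.cast_sum]
      refine Finset.sum_congr rfl fun n _ => ?_
      rw [Rat.smul_one_eq_cast, ← Rat.cast_mul]
      congr 1
      field_simp
    simp only [hsum] at htN
    let T : hP.symmSubfield := ⟨t, hP.star_eq ht⟩
    have h1 : ∀ N, ((q N - q 0 : ℚ) : ℝ) ≤ ψ T := by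
      intro N
      have : ((q N - q 0 : ℚ) : hP.symmSubfield) ≤ T := by
        rw [hle, hcast]
        exact (htN N).1
      simpa only [map_ratCast] using OrderHomClass.mono ψ this
    have h2 : ∀ N, ψ T ≤ ((q N - q 0 + 4 / 3 / 4 ^ N : ℚ) : ℝ) := by
      intro N
      have : T ≤ ((q N - q 0 + 4 / 3 / 4 ^ N : ℚ) : hP.symmSubfield) := by
        rw [hle, hcast]
        refine Eq.mp (congrArg (· ∈ P) ?_) (htN N).2
        rw [Rat.cast_add]
        simp only [T]
        abel
      simpa only [map_ratCast] using OrderHomClass.mono ψ this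
    refine ⟨T + (q 0 : ℚ), ?_⟩
    rw [map_add, map_ratCast]
    have h3 : ∀ N : ℕ, |ψ T + q 0 - r| ≤ 4 / 3 * (1 / 4) ^ N := by
      intro N
      have e1 := h1 N
      have e2 := h2 N
      have e3 := hq1 N
      have e4 := hq2 N
      push_cast at e1 e2
      have e5 : (4 / 3 * (1 / 4) ^ N : ℝ) = 4 / 3 / 4 ^ N := by
        rw [one_div_pow]
        ring
      have e6 : (1 / 4 ^ N : ℝ) ≤ 4 / 3 / 4 ^ N := by gcongr; norm_num
      rw [e5, abs_le]
      constructor <;> linarith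
    have h4 : Filter.Tendsto (fun N : ℕ => (4 / 3 * (1 / 4) ^ N : ℝ)) Filter.atTop
        (nhds (4 / 3 * 0)) :=
      (tendsto_pow_atTop_nhds_zero_of_lt_one (by norm_num) (by norm_num)).const_mul _
    rw [mul_zero] at h4
    have h5 := ge_of_tendsto' h4 h3
    exact sub_eq_zero.1 (abs_eq_zero.1 (le_antisymm h5 (abs_nonneg _)))
  let Ψ : hP.symmSubfield ≃+* ℝ := RingEquiv.ofBijective (ψ : hP.symmSubfield →+* ℝ)
    ⟨(ψ : hP.symmSubfield →+* ℝ).injective, hψ⟩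
  have hΨ : ∀ x, ψ x = Ψ x := fun _ => rfl
  refine ⟨hP.symmSubfield.subtype.comp (Ψ.symm : ℝ →+* hP.symmSubfield), fun k hk => ?_,
    fun r => (Ψ.symm r).2, fun r k => hP.commute_of_symm (Ψ.symm r).2 k, fun r hr => ?_⟩
  · refine ⟨Ψ ⟨k, hk⟩, ?_⟩
    simp
  · have h1 : 0 ≤ Ψ.symm r := by
      rw [hle]
      simpa using hr
    have h2 := OrderHomClass.mono ψ h1
    rwa [map_zero, hΨ, RingEquiv.apply_symm_apply] at h2

end IsSeriesCone

section frobenius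

variable {K : Type*} [DivisionRing K] [StarRing K]

/-- The inverse of a bijective star-preserving ring homomorphism, as a star-preserving ring
equivalence. -/
theorem exists_starRingEquiv_of_bijective {A : Type*} [Ring A] [StarRing A] (g : A →+* K)
    (hg : Function.Bijective g) (hs : ∀ z, g (star z) = star (g z)) :
    ∃ f : K ≃+* A, ∀ k, f (star k) = star (f k) := by
  let e := RingEquiv.ofBijective g hg
  refine ⟨e.symm, fun k => ?_⟩
  obtain ⟨z, rfl⟩ := e.surjective k
  have : star (e z) = e (star z) := (hs z).symm
  rw [this, e.symm_apply_apply, e.symm_apply_apply]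

variable [Algebra ℝ K] [StarModule ℝ K]

/-- Frobenius' theorem for division rings with involution: if the self-adjoint elements are the
real scalars and the elements `k * star k` are nonnegative, then the ring with involution is one of
the three standard ones. -/
theorem real_complex_quaternion_of_symm (hS : ∀ k : K, star k = k → ∃ r : ℝ, k = r • 1)
    (hpos : ∀ (k : K) (r : ℝ), k * star k = r • 1 → 0 ≤ r) :
    (∃ f : K ≃+* ℝ, ∀ k, f (star k) = f k) ∨
    (∃ f : K ≃+* ℂ, ∀ k, f (star k) = star (f k)) ∨
    (∃ f : K ≃+* Quaternion ℝ, ∀ k, f (star k) = star (f k)) := by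
  have hdec : ∀ k : K, ∃ (r : ℝ) (y : K), star y = -y ∧ k = r • 1 + y := by
    intro k
    obtain ⟨r, hr⟩ := hS (k + star k) (by rw [star_add, star_star, add_comm])
    refine ⟨r / 2, k - (r / 2) • 1, ?_, by abel⟩
    have h1 : star k = r • 1 - k := eq_sub_of_add_eq' hr
    rw [star_sub, star_smul, star_one, h1, star_trivial (r / 2)]
    module
  have hnorm : ∀ y : K, star y = -y → y ≠ 0 → ∃ c : ℝ, c ≠ 0 ∧ (c • y) * (c • y) = -1 := by
    intro y hy h0
    obtain ⟨r, hr⟩ := hS (y * star y) (by rw [star_mul, star_star])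
    have h1 : 0 < r := by
      refine lt_of_le_of_ne (hpos y r hr) ?_
      rintro rfl
      rw [zero_smul, mul_eq_zero, star_eq_zero, or_self] at hr
      exact h0 hr
    have h2 : y * y = (-r) • 1 := by
      rw [hy, mul_neg] at hr
      rw [← neg_neg (y * y), hr, neg_smul]
    refine ⟨(√r)⁻¹, by positivity, ?_⟩
    rw [smul_mul_smul, h2, smul_smul, ← mul_inv, Real.mul_self_sqrt h1.le, mul_neg,
      inv_mul_cancel₀ h1.ne', neg_smul, one_smul]
  have hskew : ∀ (y : K) (c : ℝ), star y = -y → star (c • y) = -(c • y) := by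
    intro y c hy
    rw [star_smul, star_trivial, hy, smul_neg]
  by_cases hreal : ∀ y : K, star y = -y → y = 0
  · left
    refine exists_starRingEquiv_of_bijective (algebraMap ℝ K)
      ⟨(algebraMap ℝ K).injective, fun k => ?_⟩ fun r => ?_
    · obtain ⟨r, y, hy, rfl⟩ := hdec k
      exact ⟨r, by rw [hreal y hy, add_zero, Algebra.algebraMap_eq_smul_one]⟩
    · rw [star_trivial, Algebra.algebraMap_eq_smul_one, star_smul, star_one, star_trivial]
  right
  push Not at hreal
  obtain ⟨y, hy, hy0⟩ := hreal
  obtain ⟨c, hc0, hc⟩ := hnorm y hy hy0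
  obtain ⟨i, his, hii⟩ : ∃ i : K, star i = -i ∧ i * i = -1 := ⟨c • y, hskew y c hy, hc⟩
  clear hc hc0 c hy hy0 y
  have hi0 : i ≠ 0 := by
    rintro rfl
    simp at hii
  by_cases hcomplex : ∀ y : K, star y = -y → ∃ r : ℝ, y = r • i
  · left
    refine exists_starRingEquiv_of_bijective (Complex.liftAux i hii : ℂ →+* K)
      ⟨(Complex.liftAux i hii : ℂ →+* K).injective, fun k => ?_⟩ fun z => ?_
    · obtain ⟨r, y, hy, rfl⟩ := hdec k
      obtain ⟨s, rfl⟩ := hcomplex y hy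
      refine ⟨⟨r, s⟩, ?_⟩
      simp [Complex.liftAux_apply, Algebra.algebraMap_eq_smul_one]
    · simp [Complex.liftAux_apply, Algebra.algebraMap_eq_smul_one, star_smul, his]
  right
  push Not at hcomplex
  obtain ⟨y, hy, hyi⟩ := hcomplex
  have hanti : ∀ y : K, star y = -y → ∃ b : ℝ, y * i + i * y = b • 1 := fun y hy =>
    hS _ (by rw [star_add, star_mul, star_mul, hy, his, neg_mul_neg, neg_mul_neg, add_comm])
  obtain ⟨b, hb⟩ := hanti y hy
  obtain ⟨z, hzs, hz0, hzi⟩ : ∃ z : K, star z = -z ∧ z ≠ 0 ∧ z * i = -(i * z) := by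
    refine ⟨y + (b / 2) • i, ?_, fun h => hyi (-(b / 2)) ?_, ?_⟩
    · rw [star_add, hy, hskew i _ his]
      abel
    · rw [neg_smul]
      exact eq_neg_of_add_eq_zero_left h
    · have h1 : y * i = b • 1 - i * y := eq_sub_of_add_eq hb
      rw [add_mul, mul_add, smul_mul_assoc, mul_smul_comm, hii, h1]
      module
  obtain ⟨c, hc0, hc⟩ := hnorm z hzs hz0
  obtain ⟨j, hjs, hj0, hji, hjj⟩ :
      ∃ j : K, star j = -j ∧ j ≠ 0 ∧ j * i = -(i * j) ∧ j * j = -1 :=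
    ⟨c • z, hskew z c hzs, smul_ne_zero hc0 hz0, by
      rw [smul_mul_assoc, hzi, smul_neg, mul_smul_comm], hc⟩
  clear hc hc0 c hzs hz0 hzi z hb b hyi hy y
  have hks : star (i * j) = -(i * j) := by rw [star_mul, his, hjs, neg_mul_neg, hji]
  have hkk : (i * j) * (i * j) = -1 := by
    rw [mul_assoc, ← mul_assoc j, hji, neg_mul, mul_neg, mul_assoc, ← mul_assoc i i, hii, hjj]
    simp
  let B : QuaternionAlgebra.Basis K (-1 : ℝ) 0 (-1) :=
    { i := i
      j := j
      k := i * j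
      i_mul_i := by simp [hii]
      j_mul_j := by simp [hjj]
      i_mul_j := rfl
      j_mul_i := by simp [hji] }
  let g : Quaternion ℝ →+* K := (B.liftHom : Quaternion ℝ →ₐ[ℝ] K).toRingHom
  have hB : ∀ q : Quaternion ℝ, g q = q.re • 1 + q.imI • i + q.imJ • j + q.imK • (i * j) := by
    intro q
    refine (show g q = B.lift q from rfl).trans ?_
    simp [QuaternionAlgebra.Basis.lift, B, Algebra.algebraMap_eq_smul_one]
  refine exists_starRingEquiv_of_bijective g ⟨g.injective, fun k => ?_⟩ fun q => ?_
  · have hcomp : ∀ (u y : K), star u = -u → u * u = -1 → star y = -y →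
        ∃ b : ℝ, (y + b • u) * u = -(u * (y + b • u)) := by
      intro u y hu huu hy
      obtain ⟨b, hb⟩ := hS (y * u + u * y)
        (by rw [star_add, star_mul, star_mul, hy, hu, neg_mul_neg, neg_mul_neg, add_comm])
      refine ⟨b / 2, ?_⟩
      have h1 : y * u = b • 1 - u * y := eq_sub_of_add_eq hb
      rw [add_mul, mul_add, smul_mul_assoc, mul_smul_comm, huu, h1]
      module
    obtain ⟨r, y, hy, rfl⟩ := hdec k
    obtain ⟨b₁, h₁⟩ := hcomp i y his hii hy
    obtain ⟨b₂, h₂⟩ := hcomp j y hjs hjj hy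
    obtain ⟨b₃, h₃⟩ := hcomp (i * j) y hks hkk hy
    have hij : i * j * i = -(i * (i * j)) := by rw [mul_assoc, hji, mul_neg]
    have hij' : i * j * j = -(j * (i * j)) := by rw [← mul_assoc, hji, neg_mul, neg_neg]
    set w := y + b₁ • i + b₂ • j + b₃ • (i * j) with hw
    have e₁ : w * i = -(i * w) := by
      have : w = (y + b₁ • i) + b₂ • j + b₃ • (i * j) := rfl
      rw [this, add_mul, add_mul, h₁]
      simp only [mul_add, smul_mul_assoc, mul_smul_comm, hji, hij]
      module
    have e₂ : w * j = -(j * w) := by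
      have : w = (y + b₂ • j) + b₁ • i + b₃ • (i * j) := by rw [hw]; abel
      rw [this, add_mul, add_mul, h₂]
      simp only [mul_add, smul_mul_assoc, mul_smul_comm, hji, hij']
      module
    have e₃ : w * (i * j) = -((i * j) * w) := by
      have : w = (y + b₃ • (i * j)) + b₁ • i + b₂ • j := by rw [hw]; abel
      rw [this, add_mul, add_mul, h₃]
      simp only [mul_add, smul_mul_assoc, mul_smul_comm, hij, hij']
      module
    have e₄ : w * (i * j) = (i * j) * w := by
      rw [← mul_assoc, e₁, neg_mul, mul_assoc, e₂, mul_neg, neg_neg, mul_assoc]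
    have hw0 : w = 0 := by
      rw [e₃, neg_eq_iff_add_eq_zero, ← two_smul ℝ] at e₄
      simpa [hi0, hj0] using e₄
    refine ⟨⟨r, -b₁, -b₂, -b₃⟩, ?_⟩
    refine (hB _).trans ?_
    have hy' : y = -(b₁ • i) - b₂ • j - b₃ • (i * j) := by
      rw [← sub_eq_zero, ← hw0, hw]
      abel
    rw [hy']
    module
  · rw [hB, hB]
    simp only [Quaternion.re_star, Quaternion.imI_star, Quaternion.imJ_star, Quaternion.imK_star,
      star_add, star_smul, star_one, star_trivial, hks, his, hjs]
    module

end frobenius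

namespace HermitianSpace

variable {K E : Type*} [DivisionRing K] [AddCommGroup E] [Module K E]

theorem IsOrthonormal.isSeriesCone {h : HermitianSpace K E} {e : ℕ × ℕ → E} [CharZero K]
    (he : h.IsOrthonormal e) (hom : h.Orthomodular) :
    letI := h.starRing
    IsSeriesCone (h.cone e) :=
  letI := h.starRing
  { star_eq := fun hs => star_of_mem_cone hs
    conj_mem := fun hs k => conj_mem_cone hs k
    one_mem := he.one_mem_cone
    add_mem := fun hs ht => he.add_mem_cone hom hs ht
    eq_zero_of_neg_mem := fun hs hs' => he.eq_zero_of_neg_mem_cone hom hs hs'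
    eq_zero_of_infinitesimal := fun ht => he.eq_zero_of_infinitesimal hom ht
    exists_series := fun hs hs' => he.exists_series hom hs hs' }

/-- An infinite orthonormal sequence yields a cone for which suitable series converge. -/
theorem IsOrthonormal.exists_isSeriesCone {h : HermitianSpace K E} {e : ℕ → E}
    (he : h.IsOrthonormal e) (hom : h.Orthomodular) :
    letI := h.starRing
    ∃ P : Set K, IsSeriesCone P :=
  haveI := he.charZero hom
  ⟨_, (he.comp (f := fun p : ℕ × ℕ => Nat.pair p.1 p.2)
    Nat.pairEquiv.injective).isSeriesCone hom⟩

/-- The form `⟨x, y⟩α⁻¹`, Hermitian with respect to the involution `ρ ↦ αρ*α⁻¹`. -/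
def rescale (h : HermitianSpace K E) (α : K) (hα : α ≠ 0) (hs : h.star α = α) :
    HermitianSpace K E where
  star ρ := α * h.star ρ * α⁻¹
  star_add a b := by rw [h.star_add, mul_add, add_mul]
  star_mul a b := by
    rw [h.star_mul]
    simp only [mul_assoc, inv_mul_cancel_left₀ hα]
  star_star a := by
    rw [h.star_mul, h.star_mul, h.star_inv, h.star_star, hs]
    simp only [mul_assoc, mul_inv_cancel_left₀ hα, mul_inv_cancel₀ hα, mul_one]
  form x y := h.form x y * α⁻¹
  form_add_left x y z := by rw [h.form_add_left, add_mul]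
  form_add_right x y z := by rw [h.form_add_right, add_mul]
  form_smul_left ρ x y := by rw [h.form_smul_left, mul_assoc]
  form_smul_right ρ x y := by
    rw [h.form_smul_right]
    simp only [mul_assoc, inv_mul_cancel_left₀ hα]
  nondeg a ha :=
    h.nondeg a fun x => (mul_eq_zero.1 (ha x)).resolve_right (inv_ne_zero hα)
  hermitian x y := by
    rw [h.star_mul, h.star_inv, hs, h.hermitian, mul_inv_cancel_left₀ hα]

theorem Orthomodular.rescale {h : HermitianSpace K E} (hom : h.Orthomodular) {α : K}
    (hα : α ≠ 0) (hs : h.star α = α) : (h.rescale α hα hs).Orthomodular := by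
  have hp : ∀ M, (h.rescale α hα hs).perp M = h.perp M := fun M => by
    ext x
    change (∀ m ∈ M, h.form x m * α⁻¹ = 0) ↔ ∀ m ∈ M, h.form x m = 0
    simp [hα]
  intro M hM
  rw [hp, hp] at hM
  rw [hp]
  exact hom M hM

end HermitianSpace

theorem IsSeriesCone.real_complex_quaternion {K : Type*} [DivisionRing K] [StarRing K] [CharZero K]
    {P : Set K} (hP : IsSeriesCone P) :
    (∃ f : K ≃+* ℝ, ∀ k, f (star k) = f k) ∨
    (∃ f : K ≃+* ℂ, ∀ k, f (star k) = star (f k)) ∨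
    (∃ f : K ≃+* Quaternion ℝ, ∀ k, f (star k) = star (f k)) := by
  obtain ⟨φ, hsymm, hstar, hcomm, hpos⟩ := hP.exists_real_hom
  let _ : Algebra ℝ K := φ.toAlgebra' fun r k => hcomm r k
  have hsmul : ∀ (r : ℝ) (k : K), r • k = φ r * k := fun r k => Algebra.smul_def r k
  have : StarModule ℝ K := ⟨fun r k => by
    rw [hsmul, hsmul, star_mul, hstar, star_trivial r, (hcomm r (star k)).eq]⟩
  refine real_complex_quaternion_of_symm (fun k hk => ?_) fun k r hk => hpos r ?_
  · obtain ⟨r, rfl⟩ := hsymm k hk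
    exact ⟨r, by rw [hsmul, mul_one]⟩
  · rw [← mul_one (φ r), ← hsmul, ← hk]
    exact hP.mul_star_mem k

/-- Solèr's Theorem, relaxed hypothesis: an infinite orthogonal sequence of nonzero
vectors on which the quadratic form takes a common value suffices to force the
coordinate `*`-field to be `ℝ`, `ℂ`, or `ℍ`. -/
theorem soler_field_common_value {K E : Type*} [DivisionRing K] [AddCommGroup E] [Module K E]
    (h : HermitianSpace K E) (hom : h.Orthomodular) (e : ℕ → E)
    (hnz : ∀ i : ℕ, e i ≠ 0)
    (horth : ∀ i j : ℕ, i ≠ j → h.form (e i) (e j) = 0)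
    (hval : ∀ i j : ℕ, h.form (e i) (e i) = h.form (e j) (e j)) :
    (∃ φ : K ≃+* ℝ, ∀ ρ : K, φ (h.star ρ) = φ ρ) ∨
    (∃ φ : K ≃+* ℂ, ∀ ρ : K, φ (h.star ρ) = star (φ ρ)) ∨
    (∃ φ : K ≃+* Quaternion ℝ, ∀ ρ : K, φ (h.star ρ) = star (φ ρ)) := by
  set α := h.form (e 0) (e 0) with hα
  have hα0 : α ≠ 0 := fun H => hnz 0 (hom.eq_zero H)
  have hs : h.star α = α := h.hermitian _ _
  have hom' := hom.rescale hα0 hs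
  have he : (h.rescale α hα0 hs).IsOrthonormal e :=
    { self := fun i => by
        change h.form (e i) (e i) * α⁻¹ = 1
        rw [hval i 0, mul_inv_cancel₀ hα0]
      ortho := fun i j hij => by
        change h.form (e i) (e j) * α⁻¹ = 0
        rw [horth i j hij, zero_mul] }
  have := he.charZero hom'
  let _ := (h.rescale α hα0 hs).starRing
  obtain ⟨P, hP⟩ := he.exists_isSeriesCone hom'
  have hstar : ∀ ρ : K, star ρ = α * h.star ρ * α⁻¹ := fun _ => rfl
  have hsα : star α = α := by rw [hstar, hs, mul_inv_cancel_right₀ hα0]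
  have heq : h.star = star := by
    funext ρ
    rw [hstar, (hP.commute_of_symm hsα _).eq, mul_inv_cancel_right₀ hα0]
  rw [heq]
  exact hP.real_complex_quaternion
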